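/- arXiv:2505.23152 — 9 statements merged into one kernel-verified Lean document; each statement's English description precedes it below -/
import Mathlib

section
/- Let σ ∈ (0,1], let n ≥ 2, and let A belong to the class 𝒜_σ of n×n matrices. Then for every x₀ ∈ ℝⁿ with x₀ ≠ 0, the limit superior as K → ∞ of ( x₀ᵀ (M^RPCD_A)^K(I) x₀ / ‖x₀‖² )^{1/K} is at most max{ (1 − 1/n)^n, (1 − σ/n)^{2n} }. -/
open Matrix Filter

/-- Lower-triangular part (including the diagonal) of a matrix. -/
def tril (n : ℕ) (M : Matrix (Fin n) (Fin n) ℝ) : Matrix (Fin n) (Fin n) ℝ :=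
  Matrix.of fun i j => if j ≤ i then M i j else 0

/-- Permutation matrix of `p`: `P e_j = e_{p j}`. -/
def permMat (n : ℕ) (p : Equiv.Perm (Fin n)) : Matrix (Fin n) (Fin n) ℝ :=
  Matrix.of fun i j => if i = p j then 1 else 0

/-- RPCD epoch iteration matrix `T_p = I - P Γ_P⁻¹ Pᵀ A`, `Γ_P = tril (Pᵀ A P)`. -/
noncomputable def rpcdMat (n : ℕ) (A : Matrix (Fin n) (Fin n) ℝ)
    (p : Equiv.Perm (Fin n)) : Matrix (Fin n) (Fin n) ℝ :=
  1 - permMat n p * (tril n ((permMat n p)ᵀ * A * permMat n p))⁻¹ * (permMat n p)ᵀ * A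

/-- The RPCD operator `M^RPCD_A(X) = (1/n!) ∑ₚ T_pᵀ X T_p`. -/
noncomputable def rpcdOp (n : ℕ) (A : Matrix (Fin n) (Fin n) ℝ)
    (X : Matrix (Fin n) (Fin n) ℝ) : Matrix (Fin n) (Fin n) ℝ :=
  ((n.factorial : ℝ))⁻¹ • ∑ p : Equiv.Perm (Fin n), (rpcdMat n A p)ᵀ * X * rpcdMat n A p

/-- Membership in the class `𝒜_σ`: `A = B ⊙ v vᵀ` where `B` is the block matrix
`diag{σ I_k + (1-σ) 𝟙 𝟙ᵀ, I_{n-k}}` for some `2 ≤ k ≤ n` and sign vector `v ∈ {±1}ⁿ`. -/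
def memA (n : ℕ) (σ : ℝ) (A : Matrix (Fin n) (Fin n) ℝ) : Prop :=
  ∃ k : ℕ, 2 ≤ k ∧ k ≤ n ∧ ∃ v : Fin n → ℝ, (∀ i, v i = 1 ∨ v i = -1) ∧
    ∀ i j, A i j = v i * v j *
      (if i = j then 1 else if (i : ℕ) < k ∧ (j : ℕ) < k then 1 - σ else 0)

theorem perp_le_small {k σ q : ℝ} (hk : 2 ≤ k) (h0 : 0 < σ) (h1 : σ ≤ 1 / 2)
    (hq0 : 0 ≤ q) (hq : q ≤ σ ^ 2) :
    (1 - σ) * k / (1 + σ) - 1 + σ * (1 - q) / (2 * (1 + σ)) *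
      ((1 + q) * (3 + σ) / (1 + σ) + 1 / k + q * (3 + σ) / (k * (1 - σ))) ≤
    (k - 1) * (1 - 2 * σ + (2 - 1 / k) * σ ^ 2 -
      4 / 3 * (1 - 1 / (2 * k)) * (1 - 1 / k) * σ ^ 3) := by
  have ha : 0 < 1 - σ := by linarith
  have hk0 : 0 < k := by linarith
  obtain ⟨h, hh⟩ : ∃ h, h = 1 / k := ⟨_, rfl⟩
  have hh0 : 0 < h := hh ▸ by positivity
  have hh1 : h ≤ 1 / 2 := by rw [hh]; exact one_div_le_one_div_of_le (by norm_num) hk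
  have hkh : k * h = 1 := by rw [hh]; field_simp
  have hq1 : q ≤ 1 := by nlinarith
  have hbr : (1 - q) * ((1 + q) * (3 + σ) / (1 + σ) + 1 / k + q * (3 + σ) / (k * (1 - σ))) ≤
      (3 + σ) / (1 + σ) + h + σ ^ 2 * (3 + σ) / (1 - σ) * h := by
    have e1 : (1 - q) * ((1 + q) * (3 + σ) / (1 + σ)) ≤ (3 + σ) / (1 + σ) := by
      have : (1 - q) * ((1 + q) * (3 + σ) / (1 + σ)) = (1 - q ^ 2) * ((3 + σ) / (1 + σ)) := by
        ring
      rw [this]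
      exact mul_le_of_le_one_left (by positivity) (by nlinarith)
    have e2 : (1 - q) * (1 / k) ≤ h := by rw [← hh]; nlinarith
    have e3 : (1 - q) * (q * (3 + σ) / (k * (1 - σ))) ≤ σ ^ 2 * (3 + σ) / (1 - σ) * h := by
      have : (1 - q) * (q * (3 + σ) / (k * (1 - σ))) =
          ((1 - q) * q) * ((3 + σ) / (1 - σ) * h) := by rw [hh]; field_simp
      rw [this, show σ ^ 2 * (3 + σ) / (1 - σ) * h = σ ^ 2 * ((3 + σ) / (1 - σ) * h) by ring]
      exact mul_le_mul_of_nonneg_right (by nlinarith) (by positivity)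
    linarith [mul_add (1 - q) ((1 + q) * (3 + σ) / (1 + σ) + 1 / k) (q * (3 + σ) / (k * (1 - σ))),
      mul_add (1 - q) ((1 + q) * (3 + σ) / (1 + σ)) (1 / k)]
  have hfrac : (1 - σ) / (1 + σ) ≤ 1 - 2 * σ + 2 * σ ^ 2 - 4 / 3 * σ ^ 3 := by
    rw [div_le_iff₀ (by positivity)]
    nlinarith [mul_nonneg (pow_nonneg h0.le 3) (sub_nonneg.2 h1)]
  have hrest : (1 - h) * (σ - 2 * σ ^ 2 + 2 / 3 * σ ^ 2 * h) +
      h * (1 / (2 * (1 + σ)) + σ ^ 2 * (3 + σ) / (2 * (1 - σ) * (1 + σ))) ≤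
      (1 + 3 * σ) / (2 * (1 + σ) ^ 2) := by
    have e0 : σ - 5 / 3 * σ ^ 2 ≤ (1 + 3 * σ) / (2 * (1 + σ) ^ 2) := by
      rw [le_div_iff₀ (by positivity)]
      nlinarith [pow_nonneg h0.le 3, pow_nonneg h0.le 4, sq_nonneg σ]
    have e1 : (σ - 5 / 3 * σ ^ 2) +
        (1 / (2 * (1 + σ)) + σ ^ 2 * (3 + σ) / (2 * (1 - σ) * (1 + σ))) ≤
        2 * ((1 + 3 * σ) / (2 * (1 + σ) ^ 2)) := by
      have : 2 * ((1 + 3 * σ) / (2 * (1 + σ) ^ 2)) - ((σ - 5 / 3 * σ ^ 2) +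
        (1 / (2 * (1 + σ)) + σ ^ 2 * (3 + σ) / (2 * (1 - σ) * (1 + σ)))) =
        (6 * (1 + 3 * σ) * (1 - σ) - (6 * σ - 10 * σ ^ 2) * (1 + σ) ^ 2 * (1 - σ) -
          3 * (1 + σ) * (1 - σ) - 3 * σ ^ 2 * (3 + σ) * (1 + σ)) /
          (6 * (1 + σ) ^ 2 * (1 - σ)) := by
        field_simp
        ring
      have h2 : 0 ≤ (6 * (1 + 3 * σ) * (1 - σ) - (6 * σ - 10 * σ ^ 2) * (1 + σ) ^ 2 * (1 - σ) -
          3 * (1 + σ) * (1 - σ) - 3 * σ ^ 2 * (3 + σ) * (1 + σ)) /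
          (6 * (1 + σ) ^ 2 * (1 - σ)) := by
        apply div_nonneg _ (by positivity)
        nlinarith [pow_nonneg h0.le 3, pow_nonneg h0.le 4, sq_nonneg σ, pow_nonneg h0.le 5,
          mul_nonneg h0.le (sub_nonneg.2 h1), mul_nonneg (pow_nonneg h0.le 2) (sub_nonneg.2 h1),
          mul_nonneg (pow_nonneg h0.le 3) (sub_nonneg.2 h1),
          mul_nonneg (pow_nonneg h0.le 4) (sub_nonneg.2 h1)]
      linarith
    have e2 : (1 - h) * (2 / 3 * σ ^ 2 * h) ≤ (1 - h) * (1 / 3 * σ ^ 2) :=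
      mul_le_mul_of_nonneg_left (by nlinarith [sq_nonneg σ]) (by linarith)
    nlinarith [mul_le_mul_of_nonneg_left e0 (show 0 ≤ 1 - 2 * h by linarith),
      mul_le_mul_of_nonneg_left e1 hh0.le]
  have hleft : (1 - σ) * k / (1 + σ) - 1 + σ * (1 - q) / (2 * (1 + σ)) *
      ((1 + q) * (3 + σ) / (1 + σ) + 1 / k + q * (3 + σ) / (k * (1 - σ))) ≤
      (1 - σ) * k / (1 + σ) - 1 + σ / (2 * (1 + σ)) *
       ((3 + σ) / (1 + σ) + h + σ ^ 2 * (3 + σ) / (1 - σ) * h) := by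
    rw [mul_div_right_comm σ (1 - q), mul_assoc (σ / _)]
    gcongr
  refine hleft.trans ?_
  have hs := mul_le_mul_of_nonneg_left hrest h0.le
  have hf := mul_le_mul_of_nonneg_left hfrac (show 0 ≤ k - 1 by linarith)
  have key : (1 - σ) * k / (1 + σ) - 1 + σ / (2 * (1 + σ)) *
       ((3 + σ) / (1 + σ) + h + σ ^ 2 * (3 + σ) / (1 - σ) * h) =
      (k - 1) * ((1 - σ) / (1 + σ)) - σ * ((1 + 3 * σ) / (2 * (1 + σ) ^ 2)) +
      σ * (h * (1 / (2 * (1 + σ)) + σ ^ 2 * (3 + σ) / (2 * (1 - σ) * (1 + σ)))) := by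
    field_simp
    ring
  have key2 : (k - 1) * (1 - 2 * σ + (2 - 1 / k) * σ ^ 2 -
      4 / 3 * (1 - 1 / (2 * k)) * (1 - 1 / k) * σ ^ 3) =
      (k - 1) * (1 - 2 * σ + 2 * σ ^ 2 - 4 / 3 * σ ^ 3) -
      σ * ((1 - h) * (σ - 2 * σ ^ 2 + 2 / 3 * σ ^ 2 * h)) := by
    rw [hh]; field_simp; ring
  rw [key, key2]
  linarith

theorem perp_le_two {σ : ℝ} (h0 : 1 / 2 ≤ σ) (h1 : σ < 1) :
    (1 - σ) * 2 / (1 + σ) - 1 + σ * (1 - σ ^ 2) / (2 * (1 + σ)) *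
      ((1 + σ ^ 2) * (3 + σ) / (1 + σ) + 1 / 2 + σ ^ 2 * (3 + σ) / (2 * (1 - σ))) ≤ 1 / 4 := by
  have ha : 0 < 1 - σ := by linarith
  have hs : 0 < σ := by linarith
  have : (1 - σ) * 2 / (1 + σ) - 1 + σ * (1 - σ ^ 2) / (2 * (1 + σ)) *
      ((1 + σ ^ 2) * (3 + σ) / (1 + σ) + 1 / 2 + σ ^ 2 * (3 + σ) / (2 * (1 - σ))) =
      (1 - σ) ^ 2 * (1 + (1 - σ) * (3 / 2 - (1 - σ) / 2)) / 2 := by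
    field_simp
    ring
  rw [this]
  nlinarith [mul_nonneg ha.le (sub_nonneg.2 h0), mul_nonneg (mul_nonneg ha.le ha.le) (sub_nonneg.2 h0)]

theorem perp_le_large {k σ q : ℝ} (hk : 3 ≤ k) (h0 : 1 / 2 ≤ σ) (h1 : σ < 1)
    (hq0 : 0 ≤ q) (hq : q ≤ σ ^ 3) (hqk : (1 - q) / (k * (1 - σ)) ≤ (1 + σ + σ ^ 2) / 3) :
    (1 - σ) * k / (1 + σ) - 1 + σ * (1 - q) / (2 * (1 + σ)) *
      ((1 + q) * (3 + σ) / (1 + σ) + 1 / k + q * (3 + σ) / (k * (1 - σ))) ≤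
    (k - 1) * ((1 - 1 / k ^ 2) / 3) := by
  have ha : 0 < 1 - σ := by linarith
  have hs : 0 < σ := by linarith
  have hk0 : 0 < k := by linarith
  obtain ⟨h, hh⟩ : ∃ h, h = 1 / k := ⟨_, rfl⟩
  have hh0 : 0 < h := hh ▸ by positivity
  have hh1 : h ≤ 1 / 3 := by rw [hh]; exact one_div_le_one_div_of_le (by norm_num) hk
  have hkh : k * h = 1 := by rw [hh]; field_simp
  have hq1 : q ≤ 1 := hq.trans (pow_le_one₀ hs.le h1.le)
  have hbr : (1 - q) * ((1 + q) * (3 + σ) / (1 + σ) + 1 / k + q * (3 + σ) / (k * (1 - σ))) ≤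
      (3 + σ) / (1 + σ) + 1 / 3 + (3 + σ) * (σ ^ 3 * ((1 + σ + σ ^ 2) / 3)) := by
    have e1 : (1 - q) * ((1 + q) * (3 + σ) / (1 + σ)) ≤ (3 + σ) / (1 + σ) := by
      have : (1 - q) * ((1 + q) * (3 + σ) / (1 + σ)) = (1 - q ^ 2) * ((3 + σ) / (1 + σ)) := by
        ring
      rw [this]
      exact mul_le_of_le_one_left (by positivity) (by nlinarith)
    have e2 : (1 - q) * (1 / k) ≤ 1 / 3 := by rw [← hh]; nlinarith
    have e3 : (1 - q) * (q * (3 + σ) / (k * (1 - σ))) ≤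
        (3 + σ) * (σ ^ 3 * ((1 + σ + σ ^ 2) / 3)) := by
      have : (1 - q) * (q * (3 + σ) / (k * (1 - σ))) =
          (3 + σ) * (q * ((1 - q) / (k * (1 - σ)))) := by ring
      rw [this]
      have : 0 ≤ (1 - q) / (k * (1 - σ)) := div_nonneg (by linarith) (by positivity)
      gcongr
    linarith [mul_add (1 - q) ((1 + q) * (3 + σ) / (1 + σ) + 1 / k) (q * (3 + σ) / (k * (1 - σ))),
      mul_add (1 - q) ((1 + q) * (3 + σ) / (1 + σ)) (1 / k)]
  have hleft : (1 - σ) * k / (1 + σ) - 1 + σ * (1 - q) / (2 * (1 + σ)) *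
      ((1 + q) * (3 + σ) / (1 + σ) + 1 / k + q * (3 + σ) / (k * (1 - σ))) ≤
      (1 - σ) * k / (1 + σ) - 1 + σ / (2 * (1 + σ)) *
       ((3 + σ) / (1 + σ) + 1 / 3 + (3 + σ) * (σ ^ 3 * ((1 + σ + σ ^ 2) / 3))) := by
    rw [mul_div_right_comm σ (1 - q), mul_assoc (σ / _)]
    gcongr
  refine hleft.trans ?_
  have hr : k / 3 - 11 / 27 ≤ (k - 1) * ((1 - 1 / k ^ 2) / 3) := by
    have : (k - 1) * ((1 - 1 / k ^ 2) / 3) = k / 3 - 1 / 3 - h / 3 + h ^ 2 / 3 := by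
      rw [hh]; field_simp; ring
    rw [this]
    nlinarith
  have hk3 : (1 - σ) * k / (1 + σ) - k / 3 ≤ (1 - σ) * 3 / (1 + σ) - 1 := by
    have : (1 - σ) * 3 / (1 + σ) - 1 - ((1 - σ) * k / (1 + σ) - k / 3) =
        (k - 3) * (4 * σ - 2) / (3 * (1 + σ)) := by field_simp; ring
    have h2 : 0 ≤ (k - 3) * (4 * σ - 2) / (3 * (1 + σ)) :=
      div_nonneg (mul_nonneg (by linarith) (by linarith)) (by positivity)
    linarith
  have hfin : (1 - σ) * 3 / (1 + σ) - 1 - 1 + σ / (2 * (1 + σ)) *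
       ((3 + σ) / (1 + σ) + 1 / 3 + (3 + σ) * (σ ^ 3 * ((1 + σ + σ ^ 2) / 3))) ≤ - (11 / 27) := by
    have e : (1 - σ) * 3 / (1 + σ) - 1 - 1 + σ / (2 * (1 + σ)) *
       ((3 + σ) / (1 + σ) + 1 / 3 + (3 + σ) * (σ ^ 3 * ((1 + σ + σ ^ 2) / 3))) =
       (18 * (1 - σ) * (1 + σ) - 12 * (1 + σ) ^ 2 + 3 * σ * (3 + σ) + σ * (1 + σ) +
        σ * (3 + σ) * (1 + σ) * (σ ^ 3 * (1 + σ + σ ^ 2))) / (6 * (1 + σ) ^ 2) := by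
      field_simp
      ring
    rw [e, div_le_iff₀ (by positivity)]
    obtain ⟨u, hu⟩ : ∃ u, u = 2 * σ - 1 := ⟨_, rfl⟩
    have hu0 : 0 ≤ u := by linarith
    have hu1 : u ≤ 1 := by linarith
    rw [show σ = (1 + u) / 2 by linarith]
    nlinarith [pow_nonneg hu0 2, pow_nonneg hu0 3, pow_nonneg hu0 4, pow_nonneg hu0 5,
      pow_nonneg hu0 6, pow_nonneg hu0 7, mul_nonneg hu0 (sub_nonneg.2 hu1),
      mul_nonneg (pow_nonneg hu0 2) (sub_nonneg.2 hu1),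
      mul_nonneg (pow_nonneg hu0 3) (sub_nonneg.2 hu1),
      mul_nonneg (pow_nonneg hu0 4) (sub_nonneg.2 hu1),
      mul_nonneg (pow_nonneg hu0 5) (sub_nonneg.2 hu1),
      mul_nonneg (pow_nonneg hu0 6) (sub_nonneg.2 hu1),
      mul_nonneg (pow_nonneg hu0 7) (sub_nonneg.2 hu1)]
  linarith

theorem one_direction_le {k σ q S₁ S₂ : ℝ} (hk : 2 ≤ k) (h0 : 0 < σ) (h1 : σ < 1)
    (hq0 : 0 ≤ q) (hS₁ : (1 - σ) * S₁ = 1 - q) (hS₂ : (1 - σ ^ 2) * S₂ = 1 - q ^ 2)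
    (hq : k * q ≤ σ * S₁) :
    σ * (k - 2 * (k * (1 - σ) + σ) * S₁ + (k * (1 - σ) + σ) ^ 2 * S₂) +
      3 / 2 * (1 - σ) * (k * q - σ * S₁) ^ 2 ≤
    (1 - 1 / k ^ 2) / 3 * (k * (σ + k * (3 / 2 * (1 - σ)))) := by
  have ha : 0 < 1 - σ := by linarith
  have hk0 : 0 < k := by linarith
  obtain ⟨w, hw⟩ : ∃ w, w = σ - (k * (1 - σ) + σ) * q := ⟨_, rfl⟩
  have hw0 : 0 ≤ w := by nlinarith
  have hw1 : w ≤ σ := by rw [hw]; have : 0 ≤ (k * (1 - σ) + σ) * q := by positivity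
                         linarith
  have hb : 0 < 1 - σ ^ 2 := by nlinarith
  have e1 : S₁ = (1 - q) / (1 - σ) := by field_simp; linarith
  have e2 : S₂ = (1 - q ^ 2) / (1 - σ ^ 2) := by field_simp; linarith
  have e3 : 1 - σ ^ 2 = (1 - σ) * (1 + σ) := by ring
  have hq' : q = (σ - w) / (k * (1 - σ) + σ) := by
    rw [hw]; field_simp; ring
  have hid : σ * (k - 2 * (k * (1 - σ) + σ) * S₁ + (k * (1 - σ) + σ) ^ 2 * S₂) +
      3 / 2 * (1 - σ) * (k * q - σ * S₁) ^ 2 =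
      (σ * ((k - 1) * (1 - σ)) * k / (1 + σ)) + (-2 * σ * w + w ^ 2 * (1 + (1 + σ) / 2)) /
        ((1 + σ) * (1 - σ)) := by
    rw [e1, e2, e3, hw]
    field_simp
    ring
  rw [hid]
  have hneg : (-2 * σ * w + w ^ 2 * (1 + (1 + σ) / 2)) / ((1 + σ) * (1 - σ)) ≤ 0 := by
    apply div_nonpos_of_nonpos_of_nonneg _ (by positivity)
    nlinarith [mul_nonneg hw0 (sub_nonneg.2 hw1), mul_nonneg hw0 ha.le,
      mul_nonneg (mul_nonneg hw0 h0.le) (sub_nonneg.2 hw1), mul_nonneg (mul_nonneg hw0 h0.le) ha.le]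
  have hmain : σ * ((k - 1) * (1 - σ)) * k / (1 + σ) ≤ (k - 1) * (1 - σ) * k / 2 := by
    rw [div_le_div_iff₀ (by positivity) (by norm_num)]
    have : 0 ≤ (k - 1) * (1 - σ) * k := mul_nonneg (mul_nonneg (by linarith) ha.le) hk0.le
    nlinarith
  have hr : (1 - 1 / k ^ 2) / 3 * (k * (σ + k * (3 / 2 * (1 - σ)))) =
      (k - 1) * (1 - σ) * k / 2 + ((k - 1) * (k + 1) * σ / (3 * k) + (k - 1) * (1 - σ) / 2) := by
    field_simp
    ring
  have hp : 0 ≤ (k - 1) * (k + 1) * σ / (3 * k) + (k - 1) * (1 - σ) / 2 := by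
    have : 0 ≤ k - 1 := by linarith
    positivity
  linarith

theorem cubic_le_one_sub_pow {x : ℝ} (h0 : 0 ≤ x) (h1 : x ≤ 1) (m : ℕ) :
    1 - m * x + m * (m - 1) / 2 * x ^ 2 - m * (m - 1) * (m - 2) / 6 * x ^ 3 ≤ (1 - x) ^ m := by
  induction m with
  | zero => simp
  | succ m ih =>
    have hm : (0 : ℝ) ≤ m * (m - 1) * (m - 2) := by
      rcases m with _ | _ | m
      · simp
      · simp
      · push_cast
        have : (0 : ℝ) ≤ m := m.cast_nonneg
        have h : ((m : ℝ) + 1 + 1) * (m + 1 + 1 - 1) * (m + 1 + 1 - 2) = (m + 2) * (m + 1) * m := by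
          ring
        rw [h]
        positivity
    rw [pow_succ (1 - x)]
    have := mul_le_mul_of_nonneg_right ih (sub_nonneg.2 h1)
    push_cast
    nlinarith [mul_nonneg hm (pow_nonneg h0 4)]

theorem cubic_le_rate {n k : ℕ} (hk : 2 ≤ k) (hkn : k ≤ n) {σ : ℝ} (h0 : 0 < σ) (h1 : σ ≤ 1 / 2) :
    1 - 2 * σ + (2 - 1 / (k : ℝ)) * σ ^ 2 -
      4 / 3 * (1 - 1 / (2 * (k : ℝ))) * (1 - 1 / (k : ℝ)) * σ ^ 3 ≤
    max ((1 - 1 / (n : ℝ)) ^ n) ((1 - σ / (n : ℝ)) ^ (2 * n)) := by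
  refine le_trans ?_ (le_max_right _ _)
  have hkR : (2 : ℝ) ≤ k := by exact_mod_cast hk
  have hnR : (k : ℝ) ≤ n := by exact_mod_cast hkn
  have hn0 : (0 : ℝ) < n := by linarith
  have hc := cubic_le_one_sub_pow (x := σ / n) (by positivity)
    ((div_le_one hn0).2 (by linarith)) (2 * n)
  refine le_trans ?_ hc
  obtain ⟨h, hh⟩ : ∃ h, h = 1 / (k : ℝ) := ⟨_, rfl⟩
  obtain ⟨g, hg⟩ : ∃ g, g = 1 / (n : ℝ) := ⟨_, rfl⟩
  have hgh : g ≤ h := by rw [hg, hh]; exact one_div_le_one_div_of_le (by linarith) hnR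
  have hg0 : 0 < g := hg ▸ by positivity
  have e1 : 1 - ((2 * n : ℕ) : ℝ) * (σ / n) + ((2 * n : ℕ) : ℝ) * (((2 * n : ℕ) : ℝ) - 1) / 2 *
      (σ / n) ^ 2 - ((2 * n : ℕ) : ℝ) * (((2 * n : ℕ) : ℝ) - 1) * (((2 * n : ℕ) : ℝ) - 2) / 6 *
      (σ / n) ^ 3 = 1 - 2 * σ + (2 - g) * σ ^ 2 - 4 / 3 * (1 - g / 2) * (1 - g) * σ ^ 3 := by
    rw [hg]; push_cast; field_simp; ring
  have e2 : 1 / (2 * (k : ℝ)) = h / 2 := by rw [hh]; ring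
  rw [e1, e2, ← hh]
  have h3 : σ ^ 3 ≤ 1 / 2 * σ ^ 2 := by nlinarith [sq_nonneg σ]
  have h4 : 0 ≤ σ ^ 2 := sq_nonneg σ
  have h5 : 0 ≤ σ ^ 3 := by positivity
  nlinarith [mul_nonneg (sub_nonneg.2 hgh) (sub_nonneg.2 h3),
    mul_nonneg (mul_nonneg (sub_nonneg.2 hgh) h5) (add_nonneg hg0.le (hg0.le.trans hgh))]

theorem one_sub_inv_sq_le_rate {n k : ℕ} (hk : 2 ≤ k) (hkn : k ≤ n) (σ : ℝ) :
    (1 - 1 / (k : ℝ) ^ 2) / 3 ≤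
    max ((1 - 1 / (n : ℝ)) ^ n) ((1 - σ / (n : ℝ)) ^ (2 * n)) := by
  refine le_trans ?_ (le_max_left _ _)
  have hkR : (2 : ℝ) ≤ k := by exact_mod_cast hk
  have hnR : (k : ℝ) ≤ n := by exact_mod_cast hkn
  have hn0 : (0 : ℝ) < n := by linarith
  have hc := cubic_le_one_sub_pow (x := 1 / (n : ℝ)) (by positivity)
    ((div_le_one hn0).2 (by linarith)) n
  refine le_trans ?_ hc
  have e1 : 1 - (n : ℝ) * (1 / n) + n * (n - 1) / 2 * (1 / n) ^ 2 -
      n * (n - 1) * (n - 2) / 6 * (1 / n) ^ 3 = (1 - 1 / (n : ℝ) ^ 2) / 3 := by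
    field_simp; ring
  rw [e1]
  gcongr

theorem sum_perm_apply {ι : Type*} [Fintype ι] [DecidableEq ι] (f : ι → ℝ) (i : ι) :
    (Fintype.card ι : ℝ) * ∑ τ : Equiv.Perm ι, f (τ i) = (Fintype.card ι).factorial * ∑ j, f j := by
  have h : ∀ j, ∑ τ : Equiv.Perm ι, f (τ j) = ∑ τ : Equiv.Perm ι, f (τ i) := fun j =>
    Fintype.sum_equiv (Equiv.mulRight (Equiv.swap i j)) _ _ (by simp)
  calc (Fintype.card ι : ℝ) * ∑ τ : Equiv.Perm ι, f (τ i)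
      = ∑ j, ∑ τ : Equiv.Perm ι, f (τ j) := by simp [h]
    _ = ∑ τ : Equiv.Perm ι, ∑ j, f j := by
        rw [Finset.sum_comm]
        exact Finset.sum_congr rfl fun τ _ => Equiv.sum_comp τ f
    _ = _ := by simp [Fintype.card_perm]

theorem sum_perm_mul_apply {ι : Type*} [Fintype ι] [DecidableEq ι] (x : ι → ℝ) {i j : ι}
    (hij : i ≠ j) :
    (Fintype.card ι : ℝ) * ((Fintype.card ι - 1) * ∑ τ : Equiv.Perm ι, x (τ i) * x (τ j)) =
      (Fintype.card ι).factorial * ((∑ l, x l) ^ 2 - ∑ l, x l ^ 2) := by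
  have h : ∀ l, l ≠ i → ∑ τ : Equiv.Perm ι, x (τ i) * x (τ l) =
      ∑ τ : Equiv.Perm ι, x (τ i) * x (τ j) := fun l hl =>
    Fintype.sum_equiv (Equiv.mulRight (Equiv.swap j l)) _ _ (by
      intro τ
      simp [Equiv.swap_apply_of_ne_of_ne hij hl.symm])
  have hsum : ∑ l, ∑ τ : Equiv.Perm ι, x (τ i) * x (τ l) =
      (∑ l, x l) * ∑ τ : Equiv.Perm ι, x (τ i) := by
    rw [Finset.sum_comm, Finset.mul_sum]
    refine Finset.sum_congr rfl fun τ _ => ?_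
    rw [← Finset.mul_sum, Equiv.sum_comp τ x, mul_comm]
  rw [← Finset.add_sum_erase _ _ (Finset.mem_univ i),
    Finset.sum_congr rfl fun l hl => h l (Finset.ne_of_mem_erase hl), Finset.sum_const,
    Finset.card_erase_of_mem (Finset.mem_univ i), Finset.card_univ, nsmul_eq_mul,
    Nat.cast_sub (Fintype.card_pos_iff.2 ⟨i⟩), Nat.cast_one] at hsum
  have h1 := sum_perm_apply x i
  have h2 := sum_perm_apply (fun l => x l ^ 2) i
  have h3 : ∑ τ : Equiv.Perm ι, x (τ i) * x (τ i) = ∑ τ : Equiv.Perm ι, x (τ i) ^ 2 := by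
    simp [sq]
  rw [h3] at hsum
  linear_combination (Fintype.card ι : ℝ) * hsum - h2 + (∑ l, x l) * h1

theorem sum_perm_linear_sq {ι : Type*} [Fintype ι] [DecidableEq ι] (hι : 2 ≤ Fintype.card ι)
    (c x : ι → ℝ) :
    ∑ τ : Equiv.Perm ι, (∑ j, c j * x (τ j)) ^ 2 = (Fintype.card ι).factorial *
      ((∑ j, c j) ^ 2 / Fintype.card ι * ((∑ j, x j) ^ 2 / Fintype.card ι) +
        (∑ j, c j ^ 2 - (∑ j, c j) ^ 2 / Fintype.card ι) / (Fintype.card ι - 1) *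
          (∑ j, x j ^ 2 - (∑ j, x j) ^ 2 / Fintype.card ι)) := by
  have hk : (2 : ℝ) ≤ Fintype.card ι := by exact_mod_cast hι
  have hk0 : (Fintype.card ι : ℝ) ≠ 0 := by linarith
  have hk1 : (Fintype.card ι : ℝ) - 1 ≠ 0 := by linarith
  set k : ℝ := (Fintype.card ι : ℝ) with hkdef
  set F : ℝ := ((Fintype.card ι).factorial : ℝ) with hF
  have hm : ∀ i j, ∑ τ : Equiv.Perm ι, x (τ i) * x (τ j) =
      F * ((∑ l, x l) ^ 2 - ∑ l, x l ^ 2) / (k * (k - 1)) +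
      if i = j then F * (∑ l, x l ^ 2) / k - F * ((∑ l, x l) ^ 2 - ∑ l, x l ^ 2) / (k * (k - 1))
        else 0 := by
    intro i j
    split_ifs with hij
    · subst hij
      have := sum_perm_apply (fun l => x l ^ 2) i
      rw [add_sub_cancel, eq_div_iff hk0]
      simp only [← sq]
      linarith
    · have := sum_perm_mul_apply x hij
      rw [add_zero, eq_div_iff (mul_ne_zero hk0 hk1)]
      linarith
  have hexp : ∑ τ : Equiv.Perm ι, (∑ j, c j * x (τ j)) ^ 2 =
      ∑ i, ∑ j, c i * c j * ∑ τ : Equiv.Perm ι, x (τ i) * x (τ j) := by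
    simp_rw [sq, Finset.sum_mul_sum, Finset.mul_sum]
    rw [Finset.sum_comm]
    refine Finset.sum_congr rfl fun i _ => ?_
    rw [Finset.sum_comm]
    refine Finset.sum_congr rfl fun j _ => Finset.sum_congr rfl fun τ _ => ?_
    ring
  rw [hexp]
  simp_rw [hm, mul_add, Finset.sum_add_distrib, ← Finset.sum_mul, ← Finset.sum_mul_sum, mul_ite,
    mul_zero, Finset.sum_ite_eq, Finset.mem_univ, if_true, ← Finset.sum_mul, ← sq]
  field_simp
  ring

/-- Coefficient of the old `j`-th coordinate in the new `i`-th coordinate after one sweep over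
the block `σ I + (1 - σ) 𝟙 𝟙ᵀ`. -/
noncomputable def stepCoeff (σ : ℝ) (i j : ℕ) : ℝ :=
  -(1 - σ) * (σ ^ i - if j ≤ i then σ ^ (i - j) else 0)

/-- Coefficient of the old `j`-th coordinate in the sum of coordinates after one sweep over
the block `σ I + (1 - σ) 𝟙 𝟙ᵀ` of size `k`. -/
noncomputable def sumCoeff (σ : ℝ) (k j : ℕ) : ℝ := σ ^ k - σ ^ (k - j)

theorem sweep_partial_sum {k : ℕ} {σ : ℝ} {x y : Fin k → ℝ}
    (h : ∀ i : Fin k, y i = -(1 - σ) * ((∑ j, if j < i then y j else x j) - x i)) {m : ℕ}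
    (hm : m ≤ k) :
    (∑ j : Fin k, if (j : ℕ) < m then y j else x j) =
      ∑ j : Fin k, (σ ^ m - if (j : ℕ) < m then σ ^ (m - j) else 0) * x j := by
  induction m with
  | zero => simp
  | succ m ih =>
    have hs : (∑ j : Fin k, if (j : ℕ) < m + 1 then y j else x j) =
        σ * ((∑ j : Fin k, if (j : ℕ) < m then y j else x j) - x ⟨m, hm⟩) := by
      have hd : (∑ j : Fin k, if (j : ℕ) < m + 1 then y j else x j) -
          (∑ j : Fin k, if (j : ℕ) < m then y j else x j) =
          ∑ j : Fin k, if j = ⟨m, hm⟩ then y j - x j else 0 := by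
        rw [← Finset.sum_sub_distrib]
        refine Finset.sum_congr rfl fun j _ => ?_
        simp only [Fin.ext_iff]
        split_ifs <;> first | omega | simp
      rw [Finset.sum_ite_eq' Finset.univ, if_pos (Finset.mem_univ _)] at hd
      have hy := h ⟨m, hm⟩
      simp only [Fin.lt_def] at hy
      linear_combination hd + hy
    rw [hs, ih (by omega)]
    have hx : x ⟨m, hm⟩ = ∑ j : Fin k, if j = ⟨m, hm⟩ then x j else 0 := by
      rw [Finset.sum_ite_eq' Finset.univ, if_pos (Finset.mem_univ _)]
    rw [hx, ← Finset.sum_sub_distrib, Finset.mul_sum]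
    refine Finset.sum_congr rfl fun j _ => ?_
    simp only [Fin.ext_iff]
    rcases lt_trichotomy (j : ℕ) m with hj | hj | hj
    · rw [if_pos hj, if_neg (by omega), if_pos (by omega), show m + 1 - (j : ℕ) = m - j + 1 by omega, pow_succ]
      ring
    · rw [if_neg (by omega), if_pos hj, if_pos (by omega), hj]
      simp
      ring
    · rw [if_neg (by omega), if_neg (by omega), if_neg (by omega)]
      ring

theorem sweep_apply {k : ℕ} {σ : ℝ} {x y : Fin k → ℝ}
    (h : ∀ i : Fin k, y i = -(1 - σ) * ((∑ j, if j < i then y j else x j) - x i)) (i : Fin k) :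
    y i = ∑ j : Fin k, stepCoeff σ i j * x j := by
  have hs := sweep_partial_sum h i.2.le
  have hx : x i = ∑ j : Fin k, if j = i then x j else 0 := by
    rw [Finset.sum_ite_eq' Finset.univ, if_pos (Finset.mem_univ _)]
  rw [h i, hx]
  simp only [Fin.lt_def]
  rw [hs, ← Finset.sum_sub_distrib, Finset.mul_sum]
  refine Finset.sum_congr rfl fun j _ => ?_
  simp only [Fin.ext_iff, stepCoeff]
  rcases lt_trichotomy (j : ℕ) i with hj | hj | hj
  · rw [if_pos hj, if_neg (by omega), if_pos (by omega)]
    ring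
  · rw [if_neg (by omega), if_pos hj, if_pos (by omega), hj]
    simp
    ring
  · rw [if_neg (by omega), if_neg (by omega), if_neg (by omega)]
    ring

theorem sweep_sum {k : ℕ} {σ : ℝ} {x y : Fin k → ℝ}
    (h : ∀ i : Fin k, y i = -(1 - σ) * ((∑ j, if j < i then y j else x j) - x i)) :
    ∑ i, y i = ∑ j : Fin k, sumCoeff σ k j * x j := by
  simpa [sumCoeff] using sweep_partial_sum h le_rfl

theorem sum_range_ite_sub {k i : ℕ} (hi : i < k) (f : ℕ → ℝ) :
    (∑ j ∈ Finset.range k, if j ≤ i then f (i - j) else 0) =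
      ∑ l ∈ Finset.range (i + 1), f l := by
  rw [← Finset.sum_filter, ← Finset.sum_range_reflect]
  refine Finset.sum_congr ?_ fun j _ => by simp
  ext j
  simp only [Finset.mem_filter, Finset.mem_range]
  omega

theorem sum_range_sub_rev (k : ℕ) (f : ℕ → ℝ) :
    ∑ j ∈ Finset.range k, f (k - j) = ∑ l ∈ Finset.range k, f (l + 1) := by
  rw [← Finset.sum_range_reflect]
  refine Finset.sum_congr rfl fun j hj => ?_
  have := Finset.mem_range.1 hj
  congr 1
  omega

theorem geom_sum_sq (σ : ℝ) (k : ℕ) :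
    (1 - σ ^ 2) * ∑ l ∈ Finset.range k, (σ ^ l) ^ 2 = 1 - (σ ^ k) ^ 2 := by
  have h := mul_neg_geom_sum (σ ^ 2) k
  simpa only [← pow_mul, mul_comm] using h

theorem sum_stepCoeff {k i : ℕ} (hi : i < k) (σ : ℝ) :
    ∑ j ∈ Finset.range k, stepCoeff σ i j = 1 - (k * (1 - σ) + σ) * σ ^ i := by
  have h := mul_neg_geom_sum σ (i + 1)
  simp only [stepCoeff]
  rw [← Finset.mul_sum, Finset.sum_sub_distrib, sum_range_ite_sub hi, Finset.sum_const,
    Finset.card_range, nsmul_eq_mul]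
  rw [pow_succ] at h
  linear_combination h

theorem sum_stepCoeff_sq {k i : ℕ} (hi : i < k) {σ : ℝ} (h0 : 0 < σ) (h1 : σ < 1) :
    ∑ j ∈ Finset.range k, stepCoeff σ i j ^ 2 - (∑ j ∈ Finset.range k, stepCoeff σ i j) ^ 2 / k =
      (1 - σ) / (1 + σ) * (1 - σ ^ 2 * (σ ^ i) ^ 2) - (1 - σ * σ ^ i) ^ 2 / k := by
  have hk : (k : ℝ) ≠ 0 := by exact_mod_cast (by omega : k ≠ 0)
  have ha : (1 - σ) ≠ 0 := by linarith
  have hA := geom_sum_sq σ (i + 1)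
  have hG := mul_neg_geom_sum σ (i + 1)
  have hsq : ∀ j, stepCoeff σ i j ^ 2 = (1 - σ) ^ 2 * ((σ ^ i) ^ 2 -
      2 * σ ^ i * (if j ≤ i then σ ^ (i - j) else 0) +
      (if j ≤ i then (σ ^ (i - j)) ^ 2 else 0)) := by
    intro j
    simp only [stepCoeff]
    split_ifs <;> ring
  rw [sum_stepCoeff hi]
  simp only [hsq]
  rw [← Finset.mul_sum, Finset.sum_add_distrib, Finset.sum_sub_distrib, ← Finset.mul_sum,
    sum_range_ite_sub hi, sum_range_ite_sub hi (fun l => (σ ^ l) ^ 2), Finset.sum_const,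
    Finset.card_range, nsmul_eq_mul]
  rw [pow_succ σ i] at hA hG
  have eG : ∑ l ∈ Finset.range (i + 1), σ ^ l = (1 - σ ^ i * σ) / (1 - σ) := by
    field_simp
    linarith
  have eA : ∑ l ∈ Finset.range (i + 1), (σ ^ l) ^ 2 =
      (1 - (σ ^ i * σ) ^ 2) / ((1 - σ) * (1 + σ)) := by
    rw [eq_div_iff (by positivity)]
    linarith
  rw [eG, eA]
  field_simp
  ring

theorem sum_sumCoeff (k : ℕ) (σ : ℝ) :
    ∑ j ∈ Finset.range k, sumCoeff σ k j =
      k * σ ^ k - σ * ∑ l ∈ Finset.range k, σ ^ l := by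
  simp only [sumCoeff]
  rw [Finset.sum_sub_distrib, sum_range_sub_rev k (fun l => σ ^ l), Finset.mul_sum]
  simp [pow_succ, mul_comm]

theorem sum_sumCoeff_sq {k : ℕ} (hk : k ≠ 0) (σ : ℝ) :
    ∑ j ∈ Finset.range k, sumCoeff σ k j ^ 2 - (∑ j ∈ Finset.range k, sumCoeff σ k j) ^ 2 / k =
      σ ^ 2 * (∑ l ∈ Finset.range k, (σ ^ l) ^ 2 - (∑ l ∈ Finset.range k, σ ^ l) ^ 2 / k) := by
  have hsq : ∀ j, sumCoeff σ k j ^ 2 =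
      (σ ^ k) ^ 2 - 2 * σ ^ k * σ ^ (k - j) + (σ ^ (k - j)) ^ 2 := by
    intro j
    simp only [sumCoeff]
    ring
  have e1 : ∑ j ∈ Finset.range k, σ ^ (k - j) = σ * ∑ l ∈ Finset.range k, σ ^ l := by
    rw [sum_range_sub_rev k (fun l => σ ^ l), Finset.mul_sum]
    simp [pow_succ, mul_comm]
  have e2 : ∑ j ∈ Finset.range k, (σ ^ (k - j)) ^ 2 =
      σ ^ 2 * ∑ l ∈ Finset.range k, (σ ^ l) ^ 2 := by
    rw [sum_range_sub_rev k (fun l => (σ ^ l) ^ 2), Finset.mul_sum]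
    exact Finset.sum_congr rfl fun j _ => by ring
  have hk' : (k : ℝ) ≠ 0 := by exact_mod_cast hk
  rw [sum_sumCoeff]
  simp only [hsq]
  rw [Finset.sum_add_distrib, Finset.sum_sub_distrib, ← Finset.mul_sum, e1, e2, Finset.sum_const,
    Finset.card_range, nsmul_eq_mul]
  field_simp
  ring

theorem perp_coeff_le {n k : ℕ} (hk : 2 ≤ k) (hkn : k ≤ n) {σ : ℝ} (h0 : 0 < σ) (h1 : σ < 1) :
    σ * (∑ i ∈ Finset.range k, (∑ j ∈ Finset.range k, stepCoeff σ i j ^ 2 -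
        (∑ j ∈ Finset.range k, stepCoeff σ i j) ^ 2 / k)) +
      3 / 2 * (1 - σ) * (∑ j ∈ Finset.range k, sumCoeff σ k j ^ 2 -
        (∑ j ∈ Finset.range k, sumCoeff σ k j) ^ 2 / k) ≤
    σ * ((k - 1) * max ((1 - 1 / (n : ℝ)) ^ n) ((1 - σ / (n : ℝ)) ^ (2 * n))) := by
  have ha : 0 < 1 - σ := by linarith
  have hkR : (2 : ℝ) ≤ k := by exact_mod_cast hk
  have hk0 : (0 : ℝ) < k := by linarith
  have hk1 : (0 : ℝ) ≤ k - 1 := by linarith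
  have hq0 : 0 ≤ σ ^ k := by positivity
  rw [Finset.sum_congr rfl fun i hi => sum_stepCoeff_sq (Finset.mem_range.1 hi) h0 h1,
    sum_sumCoeff_sq (by omega)]
  have hG := mul_neg_geom_sum σ k
  have hA := geom_sum_sq σ k
  have eG : ∑ l ∈ Finset.range k, σ ^ l = (1 - σ ^ k) / (1 - σ) := by
    field_simp
    linarith
  have eA : ∑ l ∈ Finset.range k, (σ ^ l) ^ 2 = (1 - (σ ^ k) ^ 2) / ((1 - σ) * (1 + σ)) := by
    rw [eq_div_iff (by positivity)]
    linarith
  have hsum : ∑ i ∈ Finset.range k, ((1 - σ) / (1 + σ) * (1 - σ ^ 2 * (σ ^ i) ^ 2) -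
      (1 - σ * σ ^ i) ^ 2 / k) =
      (1 - σ) / (1 + σ) * (k - σ ^ 2 * ∑ l ∈ Finset.range k, (σ ^ l) ^ 2) -
      (k - 2 * σ * ∑ l ∈ Finset.range k, σ ^ l +
        σ ^ 2 * ∑ l ∈ Finset.range k, (σ ^ l) ^ 2) / k := by
    have hsq : ∀ i : ℕ, (1 - σ * σ ^ i) ^ 2 = 1 - 2 * σ * σ ^ i + σ ^ 2 * (σ ^ i) ^ 2 :=
      fun i => by ring
    simp only [hsq]
    rw [Finset.sum_sub_distrib, ← Finset.mul_sum, ← Finset.sum_div, Finset.sum_add_distrib]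
    simp only [Finset.sum_sub_distrib, ← Finset.mul_sum, Finset.sum_const, Finset.card_range,
      nsmul_eq_mul, mul_one]
  rw [hsum, eG, eA]
  have hbound : (1 - σ) * k / (1 + σ) - 1 + σ * (1 - σ ^ k) / (2 * (1 + σ)) *
      ((1 + σ ^ k) * (3 + σ) / (1 + σ) + 1 / k + σ ^ k * (3 + σ) / (k * (1 - σ))) ≤
      (k - 1) * max ((1 - 1 / (n : ℝ)) ^ n) ((1 - σ / (n : ℝ)) ^ (2 * n)) := by
    rcases le_total σ (1 / 2) with hσ | hσ
    · exact (perp_le_small hkR h0 hσ hq0 (pow_le_pow_of_le_one h0.le h1.le hk)).trans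
        (mul_le_mul_of_nonneg_left (cubic_le_rate hk hkn h0 hσ) hk1)
    · refine le_trans ?_ (mul_le_mul_of_nonneg_left (one_sub_inv_sq_le_rate hk hkn σ) hk1)
      rcases hk.eq_or_lt with rfl | hk3
      · refine (le_of_eq_of_le ?_ (perp_le_two hσ h1)).trans ?_ <;> norm_num
      · refine perp_le_large (by exact_mod_cast hk3) hσ h1 hq0
          (pow_le_pow_of_le_one h0.le h1.le hk3) ?_
        rw [div_le_iff₀ (by positivity)]
        have hS : ∀ m : ℕ, 3 ≤ m →
            3 * ∑ l ∈ Finset.range m, σ ^ l ≤ m * (1 + σ + σ ^ 2) := by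
          intro m hm
          induction m, hm using Nat.le_induction with
          | base => simp [Finset.sum_range_succ]
          | succ m hm ih =>
            rw [Finset.sum_range_succ]
            have : σ ^ m ≤ σ ^ 2 := pow_le_pow_of_le_one h0.le h1.le (by omega)
            push_cast
            nlinarith
        have := mul_le_mul_of_nonneg_left (hS k hk3) ha.le
        linarith
  refine le_of_eq_of_le ?_ (mul_le_mul_of_nonneg_left hbound h0.le)
  field_simp
  ring

theorem one_coeff_le {n k : ℕ} (hk : 2 ≤ k) (hkn : k ≤ n) {σ : ℝ} (h0 : 0 < σ) (h1 : σ < 1) :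
    σ * (∑ i ∈ Finset.range k, (∑ j ∈ Finset.range k, stepCoeff σ i j) ^ 2) +
      3 / 2 * (1 - σ) * (∑ j ∈ Finset.range k, sumCoeff σ k j) ^ 2 ≤
    max ((1 - 1 / (n : ℝ)) ^ n) ((1 - σ / (n : ℝ)) ^ (2 * n)) *
      (k * (σ + k * (3 / 2 * (1 - σ)))) := by
  have ha : 0 < 1 - σ := by linarith
  have hkR : (2 : ℝ) ≤ k := by exact_mod_cast hk
  have hsum : ∑ i ∈ Finset.range k, (∑ j ∈ Finset.range k, stepCoeff σ i j) ^ 2 =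
      k - 2 * (k * (1 - σ) + σ) * ∑ l ∈ Finset.range k, σ ^ l +
        (k * (1 - σ) + σ) ^ 2 * ∑ l ∈ Finset.range k, (σ ^ l) ^ 2 := by
    rw [Finset.sum_congr rfl fun i hi => by rw [sum_stepCoeff (Finset.mem_range.1 hi)]]
    have hsq : ∀ i : ℕ, (1 - (k * (1 - σ) + σ) * σ ^ i) ^ 2 =
        1 - 2 * (k * (1 - σ) + σ) * σ ^ i + (k * (1 - σ) + σ) ^ 2 * (σ ^ i) ^ 2 :=
      fun i => by ring
    simp only [hsq]
    rw [Finset.sum_add_distrib, Finset.sum_sub_distrib, ← Finset.mul_sum, ← Finset.mul_sum]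
    simp
  rw [hsum, sum_sumCoeff]
  have hle : (k : ℝ) * σ ^ k ≤ σ * ∑ l ∈ Finset.range k, σ ^ l := by
    rw [Finset.mul_sum, ← nsmul_eq_mul]
    calc k • σ ^ k = ∑ _l ∈ Finset.range k, σ ^ k := by simp
      _ ≤ _ := Finset.sum_le_sum fun l hl => by
        rw [← pow_succ']
        exact pow_le_pow_of_le_one h0.le h1.le (Finset.mem_range.1 hl)
  refine (one_direction_le hkR h0 h1 (by positivity) (mul_neg_geom_sum σ k)
    (geom_sum_sq σ k) hle).trans ?_
  exact mul_le_mul_of_nonneg_right (one_sub_inv_sq_le_rate hk hkn σ) (by positivity)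

theorem rate_pos {n : ℕ} (hn : 2 ≤ n) (σ : ℝ) :
    0 < max ((1 - 1 / (n : ℝ)) ^ n) ((1 - σ / (n : ℝ)) ^ (2 * n)) := by
  refine lt_max_of_lt_left (pow_pos (sub_pos.2 ?_) _)
  have : (2 : ℝ) ≤ n := by exact_mod_cast hn
  rw [div_lt_one (by linarith)]
  linarith

/-- The Lyapunov quadratic form `σ ‖z‖² + (3/2) (1 - σ) (∑ z)²` after one sweep started at `z`. -/
noncomputable def sweepEnergy {k : ℕ} (σ : ℝ) (z : Fin k → ℝ) : ℝ :=
  σ * ∑ i : Fin k, (∑ j : Fin k, stepCoeff σ i j * z j) ^ 2 +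
    3 / 2 * (1 - σ) * (∑ j : Fin k, sumCoeff σ k j * z j) ^ 2

theorem sum_perm_sweepEnergy_le {n k : ℕ} (hk : 2 ≤ k) (hkn : k ≤ n) {σ : ℝ} (h0 : 0 < σ)
    (h1 : σ ≤ 1) (z : Fin k → ℝ) :
    ∑ τ : Equiv.Perm (Fin k), sweepEnergy σ (z ∘ τ) ≤ k.factorial *
      (max ((1 - 1 / (n : ℝ)) ^ n) ((1 - σ / (n : ℝ)) ^ (2 * n)) *
        (σ * ∑ j, z j ^ 2 + 3 / 2 * (1 - σ) * (∑ j, z j) ^ 2)) := by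
  have hr := rate_pos (hk.trans hkn) σ
  rcases h1.eq_or_lt with rfl | h1
  · have h : ∀ z : Fin k → ℝ, sweepEnergy 1 z = 0 := fun z => by
      simp [sweepEnergy, stepCoeff]
    simp only [h, Finset.sum_const_zero]
    have : 0 ≤ ∑ j, z j ^ 2 := Finset.sum_nonneg fun j _ => sq_nonneg _
    simp only [sub_self, mul_zero, zero_mul, add_zero, one_mul]
    exact mul_nonneg (Nat.cast_nonneg _) (mul_nonneg hr.le this)
  set r := max ((1 - 1 / (n : ℝ)) ^ n) ((1 - σ / (n : ℝ)) ^ (2 * n))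
  have hkR : (2 : ℝ) ≤ k := by exact_mod_cast hk
  have hk0 : (0 : ℝ) < k := by linarith
  have hk1 : (0 : ℝ) < k - 1 := by linarith
  have hperp := perp_coeff_le hk hkn h0 h1
  have hone := one_coeff_le hk hkn h0 h1
  have hcs : 0 ≤ ∑ j, z j ^ 2 - (∑ j, z j) ^ 2 / k := by
    have := sq_sum_le_card_mul_sum_sq (s := Finset.univ) (f := z)
    rw [Finset.card_univ, Fintype.card_fin] at this
    rw [sub_nonneg, div_le_iff₀ hk0]
    linarith
  have havg : ∀ c : ℕ → ℝ, ∑ τ : Equiv.Perm (Fin k), (∑ j : Fin k, c j * z (τ j)) ^ 2 =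
      k.factorial * ((∑ j ∈ Finset.range k, c j) ^ 2 / k * ((∑ j, z j) ^ 2 / k) +
        (∑ j ∈ Finset.range k, c j ^ 2 - (∑ j ∈ Finset.range k, c j) ^ 2 / k) / (k - 1) *
          (∑ j, z j ^ 2 - (∑ j, z j) ^ 2 / k)) := by
    intro c
    have := sum_perm_linear_sq (ι := Fin k) (by simpa using hk) (fun j => c j) z
    rw [Fintype.card_fin] at this
    rw [this, Fin.sum_univ_eq_sum_range (fun j => c j) k,
      Fin.sum_univ_eq_sum_range (fun j => c j ^ 2) k]
  have htot : ∑ τ : Equiv.Perm (Fin k), sweepEnergy σ (z ∘ τ) = k.factorial *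
      ((σ * (∑ i ∈ Finset.range k, (∑ j ∈ Finset.range k, stepCoeff σ i j) ^ 2) +
        3 / 2 * (1 - σ) * (∑ j ∈ Finset.range k, sumCoeff σ k j) ^ 2) / k *
          ((∑ j, z j) ^ 2 / k) +
      (σ * (∑ i ∈ Finset.range k, (∑ j ∈ Finset.range k, stepCoeff σ i j ^ 2 -
        (∑ j ∈ Finset.range k, stepCoeff σ i j) ^ 2 / k)) +
      3 / 2 * (1 - σ) * (∑ j ∈ Finset.range k, sumCoeff σ k j ^ 2 -
        (∑ j ∈ Finset.range k, sumCoeff σ k j) ^ 2 / k)) / (k - 1) *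
          (∑ j, z j ^ 2 - (∑ j, z j) ^ 2 / k)) := by
    simp only [sweepEnergy, Function.comp_apply]
    rw [Finset.sum_add_distrib, ← Finset.mul_sum, ← Finset.mul_sum, Finset.sum_comm,
      havg (sumCoeff σ k), Finset.sum_congr (g := fun i : Fin k => _) rfl
        fun i _ => havg (stepCoeff σ i),
      Fin.sum_univ_eq_sum_range (fun i => (k.factorial : ℝ) *
        ((∑ j ∈ Finset.range k, stepCoeff σ i j) ^ 2 / k * ((∑ j, z j) ^ 2 / k) +
        (∑ j ∈ Finset.range k, stepCoeff σ i j ^ 2 -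
          (∑ j ∈ Finset.range k, stepCoeff σ i j) ^ 2 / k) / (k - 1) *
          (∑ j, z j ^ 2 - (∑ j, z j) ^ 2 / k))) k, ← Finset.mul_sum, Finset.sum_add_distrib,
      ← Finset.sum_mul, ← Finset.sum_mul, ← Finset.sum_div, ← Finset.sum_div]
    ring
  rw [htot]
  refine mul_le_mul_of_nonneg_left ?_ (Nat.cast_nonneg _)
  have b1 : (σ * (∑ i ∈ Finset.range k, (∑ j ∈ Finset.range k, stepCoeff σ i j) ^ 2) +
        3 / 2 * (1 - σ) * (∑ j ∈ Finset.range k, sumCoeff σ k j) ^ 2) / k *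
          ((∑ j, z j) ^ 2 / k) ≤
      r * (σ + k * (3 / 2 * (1 - σ))) * ((∑ j, z j) ^ 2 / k) := by
    refine mul_le_mul_of_nonneg_right ?_ (by positivity)
    rw [div_le_iff₀ hk0]
    linarith
  have b2 := mul_le_mul_of_nonneg_right ((div_le_iff₀ hk1).2
    (hperp.trans_eq (show _ = r * σ * (k - 1) by ring))) hcs
  refine (add_le_add b1 b2).trans (le_of_eq ?_)
  field_simp
  ring

theorem permMat_mulVec_apply {n : ℕ} (p : Equiv.Perm (Fin n)) (u : Fin n → ℝ) (i : Fin n) :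
    (permMat n p *ᵥ u) (p i) = u i := by
  simp [permMat, mulVec, dotProduct]

theorem permMat_transpose_mulVec_apply {n : ℕ} (p : Equiv.Perm (Fin n)) (u : Fin n → ℝ)
    (i : Fin n) : ((permMat n p)ᵀ *ᵥ u) i = u (p i) := by
  simp [permMat, mulVec, dotProduct]

theorem permMat_conj_apply {n : ℕ} (A : Matrix (Fin n) (Fin n) ℝ) (p : Equiv.Perm (Fin n))
    (i j : Fin n) : ((permMat n p)ᵀ * A * permMat n p) i j = A (p i) (p j) := by
  simp [permMat, Matrix.mul_apply]

theorem det_tril_conj {n : ℕ} {A : Matrix (Fin n) (Fin n) ℝ} (hA : ∀ i, A i i = 1)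
    (p : Equiv.Perm (Fin n)) : (tril n ((permMat n p)ᵀ * A * permMat n p)).det = 1 := by
  rw [det_of_isLowerTriangular]
  · simp [tril, permMat_conj_apply, hA]
  · intro i j hij
    have : i < j := hij
    simp [tril, this.not_ge]

/-- Each coordinate update of a sweep zeroes the corresponding partial derivative. -/
theorem rpcdMat_mulVec_eq_zero {n : ℕ} {A : Matrix (Fin n) (Fin n) ℝ} (hA : ∀ i, A i i = 1)
    (p : Equiv.Perm (Fin n)) (x : Fin n → ℝ) (i : Fin n) :
    ∑ j, A (p i) (p j) * (if j ≤ i then (rpcdMat n A p *ᵥ x) (p j) else x (p j)) = 0 := by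
  set Γ := tril n ((permMat n p)ᵀ * A * permMat n p) with hΓ
  set d := Γ⁻¹ *ᵥ ((permMat n p)ᵀ *ᵥ (A *ᵥ x)) with hd
  have hy : ∀ j, (rpcdMat n A p *ᵥ x) (p j) = x (p j) - d j := by
    intro j
    rw [rpcdMat, sub_mulVec, one_mulVec, Pi.sub_apply, ← mulVec_mulVec, ← mulVec_mulVec,
      ← mulVec_mulVec, permMat_mulVec_apply]
  have hdet : IsUnit Γ.det := by
    rw [hΓ, det_tril_conj hA]
    exact isUnit_one
  have hΓd : (Γ *ᵥ d) i = (A *ᵥ x) (p i) := by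
    rw [hd, mulVec_mulVec, mul_nonsing_inv _ hdet, one_mulVec, permMat_transpose_mulVec_apply]
  have e1 : (Γ *ᵥ d) i = ∑ j, if j ≤ i then A (p i) (p j) * d j else 0 := by
    simp only [hΓ, mulVec, dotProduct, tril, of_apply, permMat_conj_apply, ite_mul, zero_mul]
  have e2 : (A *ᵥ x) (p i) = ∑ j, A (p i) (p j) * x (p j) :=
    (Equiv.sum_comp p fun j => A (p i) j * x j).symm
  rw [e1, e2] at hΓd
  rw [← sub_eq_zero.2 hΓd.symm, ← Finset.sum_sub_distrib]
  refine Finset.sum_congr rfl fun j _ => ?_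
  rw [hy]
  split_ifs <;> ring

/-- The Lyapunov form attached to a matrix of the class with block size `k` and signs `v`. -/
noncomputable def blockEnergy {n k : ℕ} (hkn : k ≤ n) (σ : ℝ) (v x : Fin n → ℝ) : ℝ :=
  σ * ∑ i, x i ^ 2 +
    3 / 2 * (1 - σ) * (∑ l : Fin k, v (Fin.castLE hkn l) * x (Fin.castLE hkn l)) ^ 2

section Block

variable {n k : ℕ} {σ : ℝ} {A : Matrix (Fin n) (Fin n) ℝ} {v : Fin n → ℝ}

theorem blockEnergy_rpcdMat (hkn : k ≤ n) (hv : ∀ i, v i = 1 ∨ v i = -1)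
    (hA : ∀ i j, A i j = v i * v j *
      (if i = j then 1 else if (i : ℕ) < k ∧ (j : ℕ) < k then 1 - σ else 0))
    (q : Equiv.Perm (Fin n)) (e : Fin k ↪o Fin n) (ρ : Equiv.Perm (Fin k))
    (hq : ∀ l, q (e l) = Fin.castLE hkn (ρ l)) (x : Fin n → ℝ) :
    blockEnergy hkn σ v (rpcdMat n A q *ᵥ x) =
      sweepEnergy σ ((fun l => v (Fin.castLE hkn l) * x (Fin.castLE hkn l)) ∘ ρ) := by
  have hv2 : ∀ i, v i * v i = 1 := fun i => by rcases hv i with h | h <;> rw [h] <;> norm_num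
  set y := rpcdMat n A q *ᵥ x with hy
  have hout : ∀ j, j ∉ Set.range e → ¬ (q j : ℕ) < k := by
    intro j hj hlt
    refine hj ⟨ρ.symm ⟨q j, hlt⟩, q.injective ?_⟩
    rw [hq, ρ.apply_symm_apply]
    rfl
  have hin : ∀ l, (q (e l) : ℕ) < k := fun l => by
    rw [hq]
    exact (ρ l).2
  have hsweep := rpcdMat_mulVec_eq_zero (A := A) (fun i => by simp [hA, hv2]) q x
  simp only [hA, ← hy, q.injective.eq_iff] at hsweep
  have hzero : ∀ j, j ∉ Set.range e → y (q j) = 0 := by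
    intro i hi
    have h := hsweep i
    rw [Finset.sum_eq_single i] at h
    · simpa [hv2] using h
    · intro j _ hj
      simp [hj.symm, hout i hi]
    · simp
  set Z : Fin k → ℝ := (fun l => v (Fin.castLE hkn l) * x (Fin.castLE hkn l)) ∘ ρ with hZ
  set Y : Fin k → ℝ := (fun l => v (Fin.castLE hkn l) * y (Fin.castLE hkn l)) ∘ ρ with hY
  have hYe : ∀ l, Y l = v (q (e l)) * y (q (e l)) := fun l => by simp [hY, hq]
  have hZe : ∀ l, Z l = v (q (e l)) * x (q (e l)) := fun l => by simp [hZ, hq]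
  have hrec : ∀ i : Fin k, Y i = -(1 - σ) * ((∑ j, if j < i then Y j else Z j) - Z i) := by
    intro i
    have h := hsweep (e i)
    rw [← Fintype.sum_of_injective e e.injective
      (fun j => v (q (e i)) * (if i = j then Y i else (1 - σ) * if j < i then Y j else Z j))] at h
    · rw [← Finset.mul_sum] at h
      have h' := congrArg (v (q (e i)) * ·) h
      simp only [← mul_assoc, hv2, one_mul, mul_zero] at h'
      rw [← Finset.add_sum_erase _ _ (Finset.mem_univ i)] at h' ⊢
      rw [if_pos rfl, Finset.sum_congr rfl fun j hj => if_neg (Finset.ne_of_mem_erase hj).symm,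
        ← Finset.mul_sum] at h'
      rw [if_neg (lt_irrefl i)]
      linear_combination h'
    · intro j hj
      have hne : e i ≠ j := fun h => hj ⟨i, h⟩
      simp [hne, hout j hj]
    · intro j
      rw [hYe, hYe, hZe]
      simp only [e.injective.eq_iff, e.le_iff_le, hin, and_self, if_true]
      rcases lt_trichotomy i j with h | rfl | h
      · simp only [h.ne, h.not_ge, h.not_gt, if_false]
        ring
      · simp only [le_refl, if_true]
        ring
      · simp only [h.ne', h.le, h, if_true, if_false]
        ring
  have hsq : ∑ i, y i ^ 2 = ∑ l, Y l ^ 2 := by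
    rw [← Equiv.sum_comp q]
    refine (Fintype.sum_of_injective e e.injective _ _ (fun j hj => ?_) fun l => ?_).symm
    · simp [hzero j hj]
    · rw [hYe, mul_pow, pow_two (v _), hv2, one_mul]
  have hsum : ∑ l : Fin k, v (Fin.castLE hkn l) * y (Fin.castLE hkn l) = ∑ l, Y l :=
    (Equiv.sum_comp ρ _).symm
  rw [blockEnergy, sweepEnergy, hsq, hsum, sweep_sum hrec]
  simp only [sweep_apply hrec]

theorem sum_blockEnergy_rpcdMat_le (hk : 2 ≤ k) (hkn : k ≤ n) (h0 : 0 < σ) (h1 : σ ≤ 1)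
    (hv : ∀ i, v i = 1 ∨ v i = -1)
    (hA : ∀ i j, A i j = v i * v j *
      (if i = j then 1 else if (i : ℕ) < k ∧ (j : ℕ) < k then 1 - σ else 0))
    (x : Fin n → ℝ) :
    ∑ p : Equiv.Perm (Fin n), blockEnergy hkn σ v (rpcdMat n A p *ᵥ x) ≤
      n.factorial * (max ((1 - 1 / (n : ℝ)) ^ n) ((1 - σ / (n : ℝ)) ^ (2 * n)) *
        blockEnergy hkn σ v x) := by
  set r := max ((1 - 1 / (n : ℝ)) ^ n) ((1 - σ / (n : ℝ)) ^ (2 * n))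
  set z : Fin k → ℝ := fun l => v (Fin.castLE hkn l) * x (Fin.castLE hkn l) with hz
  have hkf : (0 : ℝ) < k.factorial := by exact_mod_cast k.factorial_pos
  let ι : Fin k ↪ Fin n := Fin.castLEEmb hkn
  have hι : ∀ l, ι l = Fin.castLE hkn l := fun _ => rfl
  have hzx : ∑ l, z l ^ 2 ≤ ∑ i, x i ^ 2 := by
    have : ∀ l, z l ^ 2 = x (ι l) ^ 2 := fun l => by
      rcases hv (Fin.castLE hkn l) with h | h <;> simp [hz, h, hι]
    simp only [this]
    rw [← Finset.sum_map Finset.univ ι fun i => x i ^ 2]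
    exact Finset.sum_le_univ_sum_of_nonneg fun i => sq_nonneg _
  have hinner : ∀ p : Equiv.Perm (Fin n), ∑ τ : Equiv.Perm (Fin k),
      blockEnergy hkn σ v (rpcdMat n A (τ.viaFintypeEmbedding ι * p) *ᵥ x) ≤
        k.factorial * (r * blockEnergy hkn σ v x) := by
    intro p
    have hcard : (Finset.univ.filter fun i => (p i : ℕ) < k).card = k := by
      have : (Finset.univ.filter fun i => (p i : ℕ) < k) =
          Finset.univ.map (ι.trans p.symm.toEmbedding) := by
        ext i
        simp only [Finset.mem_filter, Finset.mem_univ, true_and, Finset.mem_map,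
          Function.Embedding.trans_apply, Equiv.coe_toEmbedding, hι]
        constructor
        · exact fun h => ⟨⟨p i, h⟩, by simp⟩
        · rintro ⟨l, rfl⟩
          simp
      rw [this, Finset.card_map, Finset.card_univ, Fintype.card_fin]
    let e := (Finset.univ.filter fun i => (p i : ℕ) < k).orderEmbOfFin hcard
    have he : ∀ l, (p (e l) : ℕ) < k := fun l =>
      (Finset.mem_filter.1 (Finset.orderEmbOfFin_mem _ hcard l)).2
    let ρ : Equiv.Perm (Fin k) := Equiv.ofBijective (fun l => ⟨p (e l), he l⟩)
      (Finite.injective_iff_bijective.1 fun a b h =>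
        e.injective (p.injective (Fin.ext (Fin.mk.inj h))))
    have hρ : ∀ l, p (e l) = ι (ρ l) := fun l => rfl
    have hstep : ∀ τ : Equiv.Perm (Fin k),
        blockEnergy hkn σ v (rpcdMat n A (τ.viaFintypeEmbedding ι * p) *ᵥ x) =
          sweepEnergy σ (z ∘ (τ * ρ)) := by
      intro τ
      refine blockEnergy_rpcdMat hkn hv hA _ e (τ * ρ) (fun l => ?_) x
      rw [Equiv.Perm.mul_apply, hρ, Equiv.Perm.viaFintypeEmbedding_apply_image]
      rfl
    simp only [hstep]
    rw [Fintype.sum_equiv (Equiv.mulRight ρ) (fun τ => sweepEnergy σ (z ∘ (τ * ρ)))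
      (fun τ => sweepEnergy σ (z ∘ τ)) fun _ => rfl]
    refine (sum_perm_sweepEnergy_le hk hkn h0 h1 z).trans ?_
    refine mul_le_mul_of_nonneg_left (mul_le_mul_of_nonneg_left ?_
      (rate_pos (hk.trans hkn) σ).le) hkf.le
    exact add_le_add_left (mul_le_mul_of_nonneg_left hzx h0.le) _
  have hswap : (k.factorial : ℝ) * ∑ p : Equiv.Perm (Fin n),
      blockEnergy hkn σ v (rpcdMat n A p *ᵥ x) = ∑ p : Equiv.Perm (Fin n),
        ∑ τ : Equiv.Perm (Fin k),
          blockEnergy hkn σ v (rpcdMat n A (τ.viaFintypeEmbedding ι * p) *ᵥ x) := by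
    rw [Finset.sum_comm]
    have : ∀ τ : Equiv.Perm (Fin k), ∑ p : Equiv.Perm (Fin n),
        blockEnergy hkn σ v (rpcdMat n A (τ.viaFintypeEmbedding ι * p) *ᵥ x) =
          ∑ p : Equiv.Perm (Fin n), blockEnergy hkn σ v (rpcdMat n A p *ᵥ x) := fun τ =>
      Fintype.sum_equiv (Equiv.mulLeft (τ.viaFintypeEmbedding ι)) _ _ fun _ => rfl
    rw [Finset.sum_congr rfl fun τ _ => this τ, Finset.sum_const, Finset.card_univ,
      Fintype.card_perm, Fintype.card_fin, nsmul_eq_mul]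
  refine le_of_mul_le_mul_left ?_ hkf
  rw [hswap]
  refine (Finset.sum_le_sum fun p _ => hinner p).trans (le_of_eq ?_)
  rw [Finset.sum_const, Finset.card_univ, Fintype.card_perm, Fintype.card_fin, nsmul_eq_mul]
  ring

end Block

theorem dotProduct_rpcdOp_mulVec {n : ℕ} (A X : Matrix (Fin n) (Fin n) ℝ) (x : Fin n → ℝ) :
    x ⬝ᵥ (rpcdOp n A X *ᵥ x) = (n.factorial : ℝ)⁻¹ *
      ∑ p : Equiv.Perm (Fin n), (rpcdMat n A p *ᵥ x) ⬝ᵥ (X *ᵥ (rpcdMat n A p *ᵥ x)) := by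
  rw [rpcdOp, smul_mulVec, dotProduct_smul, sum_mulVec, dotProduct_sum, smul_eq_mul]
  congr 1
  refine Finset.sum_congr rfl fun p _ => ?_
  rw [← mulVec_mulVec, ← mulVec_mulVec, mulVec_transpose, dotProduct_comm,
    ← dotProduct_mulVec, dotProduct_comm]

theorem dotProduct_iterate_rpcdOp_nonneg {n : ℕ} (A : Matrix (Fin n) (Fin n) ℝ) (K : ℕ)
    (x : Fin n → ℝ) : 0 ≤ x ⬝ᵥ ((rpcdOp n A)^[K] 1 *ᵥ x) := by
  induction K generalizing x with
  | zero => simpa [dotProduct] using Finset.sum_nonneg fun i _ => mul_self_nonneg (x i)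
  | succ K ih =>
    rw [Function.iterate_succ_apply', dotProduct_rpcdOp_mulVec]
    exact mul_nonneg (by positivity) (Finset.sum_nonneg fun p _ => ih _)

theorem dotProduct_iterate_rpcdOp_le {n : ℕ} {A : Matrix (Fin n) (Fin n) ℝ} {C r : ℝ}
    {Φ : (Fin n → ℝ) → ℝ} (hr : 0 ≤ r) (hC : 0 ≤ C) (hΦ : ∀ x, x ⬝ᵥ x ≤ C * Φ x)
    (hT : ∀ x, ∑ p : Equiv.Perm (Fin n), Φ (rpcdMat n A p *ᵥ x) ≤ n.factorial * (r * Φ x))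
    (K : ℕ) (x : Fin n → ℝ) : x ⬝ᵥ ((rpcdOp n A)^[K] 1 *ᵥ x) ≤ C * r ^ K * Φ x := by
  induction K generalizing x with
  | zero => simpa using hΦ x
  | succ K ih =>
    have hn : (0 : ℝ) < n.factorial := by exact_mod_cast n.factorial_pos
    rw [Function.iterate_succ_apply', dotProduct_rpcdOp_mulVec, inv_mul_le_iff₀ hn]
    refine (Finset.sum_le_sum fun p _ => ih _).trans ?_
    rw [← Finset.mul_sum]
    refine (mul_le_mul_of_nonneg_left (hT x) (by positivity)).trans (le_of_eq ?_)
    ring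

/-- A sequence dominated by `C * r ^ K` has root growth rate at most `r`. -/
theorem limsup_root_le {u : ℕ → ℝ} {C r : ℝ} (hC : 0 < C) (hr : 0 ≤ r) (h0 : ∀ K, 0 ≤ u K)
    (hu : ∀ K, u K ≤ C * r ^ K) : limsup (fun K : ℕ => u K ^ (1 / (K : ℝ))) atTop ≤ r := by
  have hlim : Tendsto (fun K : ℕ => C ^ (1 / (K : ℝ)) * r) atTop (nhds r) := by
    have h := (Real.continuousAt_const_rpow hC.ne').tendsto.comp
      (tendsto_one_div_atTop_nhds_zero_nat (𝕜 := ℝ))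
    simpa using h.mul_const r
  have hle : ∀ᶠ K : ℕ in atTop, u K ^ (1 / (K : ℝ)) ≤ C ^ (1 / (K : ℝ)) * r := by
    filter_upwards [eventually_ne_atTop 0] with K hK
    refine (Real.rpow_le_rpow (h0 K) (hu K) (by positivity)).trans (le_of_eq ?_)
    rw [Real.mul_rpow hC.le (by positivity), one_div, Real.pow_rpow_inv_natCast hr hK]
  rw [← hlim.limsup_eq]
  refine limsup_le_limsup hle ?_ hlim.isBoundedUnder_le
  exact IsCoboundedUnder.of_frequently_ge (a := 0)
    (Frequently.of_forall fun K => Real.rpow_nonneg (h0 K) _)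

/-- RPCD upper bound (Theorem 3.3) for Hessians in the class `𝒜_σ`. -/
theorem rpcd_upper_bound (n : ℕ) (hn : 2 ≤ n) (σ : ℝ) (hσ0 : 0 < σ) (hσ1 : σ ≤ 1)
    (A : Matrix (Fin n) (Fin n) ℝ) (hA : memA n σ A)
    (x₀ : EuclideanSpace ℝ (Fin n)) (hx₀ : x₀ ≠ 0) :
    Filter.limsup (fun K : ℕ =>
        ((x₀ ⬝ᵥ (((rpcdOp n A)^[K]) (1 : Matrix (Fin n) (Fin n) ℝ)).mulVec x₀) /
          ‖x₀‖ ^ 2) ^ (1 / (K : ℝ))) Filter.atTop ≤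
      max ((1 - 1 / (n : ℝ)) ^ n) ((1 - σ / (n : ℝ)) ^ (2 * n)) := by
  obtain ⟨k, hk, hkn, v, hv, hA⟩ := hA
  have hr := rate_pos hn σ
  have hΦ : ∀ x, x ⬝ᵥ x ≤ σ⁻¹ * blockEnergy hkn σ v x := by
    intro x
    rw [le_inv_mul_iff₀ hσ0, blockEnergy]
    have : 0 ≤ 1 - σ := sub_nonneg.2 hσ1
    simp only [dotProduct, ← pow_two]
    exact le_add_of_nonneg_right (by positivity)
  have hpos : 0 < (x₀ : Fin n → ℝ) ⬝ᵥ x₀ := by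
    have h : (x₀ : Fin n → ℝ) ≠ 0 := fun h => hx₀ (PiLp.ext fun i => congrFun h i)
    exact (Finset.sum_nonneg fun i _ => mul_self_nonneg (x₀ i)).lt_of_ne' fun h' =>
      h (dotProduct_self_eq_zero.1 h')
  have hΦ₀ : 0 < σ⁻¹ * blockEnergy hkn σ v x₀ := hpos.trans_le (hΦ _)
  have hnorm : 0 < ‖x₀‖ := norm_pos_iff.2 hx₀
  refine limsup_root_le (C := σ⁻¹ * blockEnergy hkn σ v x₀ / ‖x₀‖ ^ 2) (by positivity) hr.le
    (fun K => div_nonneg (dotProduct_iterate_rpcdOp_nonneg A K _) (by positivity)) fun K => ?_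
  rw [div_mul_eq_mul_div]
  refine div_le_div_of_nonneg_right ?_ (by positivity)
  refine (dotProduct_iterate_rpcdOp_le hr.le (inv_nonneg.2 hσ0.le) hΦ
    (sum_blockEnergy_rpcdMat_le hk hkn hσ0 hσ1 hv hA) K x₀).trans (le_of_eq ?_)
  ring
end

section
/- Let n ≥ 2 and let Q be any n×n real matrix. Then the average over all n! permutations p of {1,…,n} of P Q Pᵀ, where P is the permutation matrix of p, equals τ₁ I + τ₂ 𝟙𝟙ᵀ, where 𝟙 is the all-ones vector, τ₂ = (𝟙ᵀ Q 𝟙 − tr Q)/(n(n−1)), and τ₁ = tr(Q)/n − τ₂. -/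
open Matrix

namespace Equiv.Perm

variable {α : Type*} [DecidableEq α]

theorem exists_apply_eq_apply_eq {a b c d : α} (hab : a ≠ b) (hcd : c ≠ d) :
    ∃ σ : Equiv.Perm α, σ a = c ∧ σ b = d := by
  refine ⟨Equiv.swap (Equiv.swap a c b) d * Equiv.swap a c, ?_, by simp⟩
  have h : c ≠ Equiv.swap a c b := fun h =>
    hab ((Equiv.swap a c).injective (by rw [← h, Equiv.swap_apply_left]))
  simp [Equiv.swap_apply_of_ne_of_ne h hcd]

variable [Fintype α]

theorem sum_apply_mul_right (σ : Equiv.Perm α) (f : α → α → ℝ) (a b : α) :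
    ∑ p : Equiv.Perm α, f (p (σ a)) (p (σ b)) = ∑ p : Equiv.Perm α, f (p a) (p b) :=
  Fintype.sum_equiv (Equiv.mulRight σ) _ _ fun _ => rfl

theorem card_mul_sum_apply_self (f : α → α → ℝ) (a : α) :
    (Fintype.card α : ℝ) * ∑ p : Equiv.Perm α, f (p a) (p a) =
      (Fintype.card α).factorial * ∑ x, f x x := by
  have h (x : α) : ∑ p : Equiv.Perm α, f (p x) (p x) = ∑ p : Equiv.Perm α, f (p a) (p a) := by
    simpa using sum_apply_mul_right (Equiv.swap a x) f a a
  calc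
    _ = ∑ x, ∑ p : Equiv.Perm α, f (p x) (p x) := by simp [h]
    _ = ∑ p : Equiv.Perm α, ∑ x, f x x := by
      rw [Finset.sum_comm]
      exact Finset.sum_congr rfl fun p _ => Equiv.sum_comp p fun x => f x x
    _ = _ := by simp [Fintype.card_perm]

theorem card_mul_sum_apply_of_ne (f : α → α → ℝ) {a b : α} (hab : a ≠ b) :
    (Fintype.card α : ℝ) * (Fintype.card α - 1) * ∑ p : Equiv.Perm α, f (p a) (p b) =
      (Fintype.card α).factorial * (∑ x, ∑ y, f x y - ∑ x, f x x) := by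
  set c := ∑ p : Equiv.Perm α, f (p a) (p b)
  set d := ∑ p : Equiv.Perm α, f (p a) (p a)
  have h (x y : α) :
      ∑ p : Equiv.Perm α, f (p x) (p y) = c + if x = y then d - c else 0 := by
    split_ifs with hxy
    · subst hxy
      simpa using sum_apply_mul_right (Equiv.swap a x) f a a
    · obtain ⟨σ, rfl, rfl⟩ := exists_apply_eq_apply_eq hab hxy
      simpa using sum_apply_mul_right σ f a b
  have hsum : ∑ x, ∑ y, ∑ p : Equiv.Perm α, f (p x) (p y) =
      (Fintype.card α).factorial * ∑ x, ∑ y, f x y := by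
    calc
      _ = ∑ p : Equiv.Perm α, ∑ x, ∑ y, f (p x) (p y) := by
        rw [Finset.sum_comm (s := (Finset.univ : Finset (Equiv.Perm α)))]
        exact Finset.sum_congr rfl fun x _ => Finset.sum_comm
      _ = ∑ p : Equiv.Perm α, ∑ x, ∑ y, f x y := by
        refine Finset.sum_congr rfl fun p _ => ?_
        rw [← Equiv.sum_comp p fun x => ∑ y, f x y]
        exact Finset.sum_congr rfl fun x _ => Equiv.sum_comp p (f (p x))
      _ = _ := by simp [Fintype.card_perm]
  have hdiag := card_mul_sum_apply_self f a
  simp only [h, Finset.sum_add_distrib, Finset.sum_ite_eq, Finset.mem_univ, if_true,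
    Finset.sum_const, Finset.card_univ, nsmul_eq_mul] at hsum
  linear_combination hsum - hdiag

end Equiv.Perm

theorem permMat_mul_mul_transpose_apply {n : ℕ} (p : Equiv.Perm (Fin n))
    (Q : Matrix (Fin n) (Fin n) ℝ) (i j : Fin n) :
    (permMat n p * Q * (permMat n p)ᵀ) i j = Q (p⁻¹ i) (p⁻¹ j) := by
  simp [Matrix.mul_apply, permMat, ← Equiv.Perm.inv_eq_iff_eq]

/-- Lemma (expected permutation, Lee–Wright): the average of `P Q Pᵀ` over all
permutations equals `τ₁ I + τ₂ 𝟙𝟙ᵀ` with `τ₂ = (𝟙ᵀQ𝟙 − tr Q)/(n(n−1))` and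
`τ₁ = tr Q / n − τ₂`. -/
theorem expected_perm_conjugation (n : ℕ) (hn : 2 ≤ n)
    (Q : Matrix (Fin n) (Fin n) ℝ) :
    ((n.factorial : ℝ))⁻¹ • ∑ p : Equiv.Perm (Fin n),
        permMat n p * Q * (permMat n p)ᵀ =
      (Matrix.trace Q / (n : ℝ) -
          ((∑ i : Fin n, ∑ j : Fin n, Q i j) - Matrix.trace Q) / ((n : ℝ) * ((n : ℝ) - 1))) •
        (1 : Matrix (Fin n) (Fin n) ℝ) +
      (((∑ i : Fin n, ∑ j : Fin n, Q i j) - Matrix.trace Q) / ((n : ℝ) * ((n : ℝ) - 1))) •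
        Matrix.of (fun _ _ : Fin n => (1 : ℝ)) := by
  have hn0 : (n : ℝ) ≠ 0 := by positivity
  have hn1 : (n : ℝ) - 1 ≠ 0 := by
    have : (2 : ℝ) ≤ n := by exact_mod_cast hn
    linarith
  have hfac : (n.factorial : ℝ) ≠ 0 := by positivity
  ext i j
  have hinv : ∑ p : Equiv.Perm (Fin n), Q (p⁻¹ i) (p⁻¹ j) =
      ∑ p : Equiv.Perm (Fin n), Q (p i) (p j) :=
    Equiv.sum_comp (Equiv.inv (Equiv.Perm (Fin n))) fun p => Q (p i) (p j)
  simp only [Matrix.smul_apply, Matrix.sum_apply, Matrix.add_apply, Matrix.of_apply,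
    permMat_mul_mul_transpose_apply, hinv, smul_eq_mul, mul_one]
  rw [inv_mul_eq_iff_eq_mul₀ hfac]
  by_cases hij : i = j
  · subst hij
    have h := Equiv.Perm.card_mul_sum_apply_self Q i
    rw [Fintype.card_fin] at h
    rw [Matrix.one_apply_eq, mul_one, sub_add_cancel, ← mul_div_assoc, eq_div_iff hn0, mul_comm]
    exact h
  · have h := Equiv.Perm.card_mul_sum_apply_of_ne Q hij
    rw [Fintype.card_fin] at h
    rw [Matrix.one_apply_ne hij, mul_zero, zero_add, ← mul_div_assoc,
      eq_div_iff (mul_ne_zero hn0 hn1), mul_comm]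
    exact h
end

section
/- Let n ≥ 2, σ ∈ (0,1], and let A = σI + (1−σ)𝟙𝟙ᵀ be the n×n permutation-invariant matrix. Let Γ = tril(A), C = I − Γ⁻¹A, and set α = ‖C𝟙‖² (= 𝟙ᵀCᵀC𝟙), β = tr(CᵀC), γ = (𝟙ᵀC𝟙)², and δ = ‖Cᵀ𝟙‖². Then nβ − α ≥ 0, nδ − γ ≥ 0, α − β ≥ 0, and γ − δ ≥ 0. -/
open Matrix

open Finset in
/-- A row of the unit lower triangular matrix with constant `a` below the diagonal, applied to `g`. -/
lemma sum_range_unit_lower_mul (a : ℝ) (g : ℕ → ℝ) (i n : ℕ) (h : i < n) :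
    ∑ k ∈ range n, (if k ≤ i then (if i = k then 1 else a) else 0) * g k
      = g i + a * ∑ k ∈ range i, g k := by
  induction n, h using Nat.le_induction with
  | base =>
    rw [sum_range_succ, mul_sum, add_comm]
    congr 1
    · simp
    · refine sum_congr rfl fun k hk => ?_
      have hk' := mem_range.1 hk
      rw [if_pos hk'.le, if_neg hk'.ne']
  | succ m hm ih =>
    rw [sum_range_succ, ih, if_neg (by omega)]
    ring

/-- The `(i, j)` entry of `I - Γ⁻¹A`; the truncated subtraction is intended. -/
def iterEntry (σ : ℝ) (j i : ℕ) : ℝ :=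
  (σ ^ (i + 1) - σ ^ (i + 1 - j)) - (σ ^ i - σ ^ (i - j))

lemma sum_range_iterEntry (σ : ℝ) (j m : ℕ) :
    ∑ i ∈ Finset.range m, iterEntry σ j i = σ ^ m - σ ^ (m - j) := by
  unfold iterEntry
  rw [Finset.sum_range_sub (fun i => σ ^ i - σ ^ (i - j))]
  simp

lemma iterEntry_of_lt {σ : ℝ} {i j : ℕ} (h : i < j) :
    iterEntry σ j i = -((1 - σ) * σ ^ i) := by
  rw [iterEntry, Nat.sub_eq_zero_of_le h, Nat.sub_eq_zero_of_le h.le]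
  ring

lemma iterEntry_add (σ : ℝ) (j m : ℕ) :
    iterEntry σ j (j + m) = (1 - σ) * (1 - σ ^ j) * σ ^ m := by
  rw [iterEntry, show j + m + 1 - j = m + 1 by omega, Nat.add_sub_cancel_left]
  ring

lemma iterEntry_nonneg {σ : ℝ} (h0 : 0 ≤ σ) (h1 : σ ≤ 1) {i j : ℕ} (h : j ≤ i) :
    0 ≤ iterEntry σ j i := by
  obtain ⟨m, rfl⟩ := Nat.exists_eq_add_of_le h
  rw [iterEntry_add]
  have := pow_le_one₀ h0 h1 (n := j)
  exact mul_nonneg (mul_nonneg (by linarith) (by linarith)) (by positivity)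

open Finset in
/-- Distinct columns of the iteration matrix have nonnegative inner product. -/
lemma sum_iterEntry_mul_nonneg {σ : ℝ} (h0 : 0 ≤ σ) (h1 : σ ≤ 1) {j k : ℕ} (hjk : j ≤ k) (n : ℕ) :
    0 ≤ ∑ i ∈ range n, iterEntry σ j i * iterEntry σ k i := by
  rcases le_total n j with hn | hn
  · refine sum_nonneg fun i hi => ?_
    have := mem_range.1 hi
    rw [iterEntry_of_lt (by omega), iterEntry_of_lt (by omega), neg_mul_neg]
    exact mul_self_nonneg _
  have head : ∀ m ≤ j, (1 + σ) * ∑ i ∈ range m, iterEntry σ j i * iterEntry σ k i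
      = (1 - σ) * (1 - (σ ^ m) ^ 2) := by
    intro m
    induction m with
    | zero => simp
    | succ m ih =>
      intro hm
      rw [sum_range_succ, mul_add, ih (by omega), iterEntry_of_lt (by omega),
        iterEntry_of_lt (by omega)]
      ring
  have middle : ∀ m, j + m ≤ k →
      (1 + σ) * ∑ i ∈ range (j + m), iterEntry σ j i * iterEntry σ k i
        = (1 - σ) * (1 - σ ^ j) * (1 + σ ^ j * (σ ^ m) ^ 2) := by
    intro m
    induction m with
    | zero =>
      intro _
      rw [add_zero, head j le_rfl]
      ring
    | succ m ih =>
      intro hm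
      rw [← add_assoc, sum_range_succ, mul_add, ih (by omega), iterEntry_add,
        iterEntry_of_lt (by omega)]
      ring
  have middle_nonneg : ∀ m, j + m ≤ k →
      0 ≤ ∑ i ∈ range (j + m), iterEntry σ j i * iterEntry σ k i := by
    intro m hm
    refine nonneg_of_mul_nonneg_right (a := 1 + σ) ?_ (by linarith)
    rw [middle m hm]
    have := pow_le_one₀ h0 h1 (n := j)
    exact mul_nonneg (mul_nonneg (by linarith) (by linarith)) (by positivity)
  rcases le_total n k with hnk | hnk
  · obtain ⟨m, rfl⟩ := Nat.exists_eq_add_of_le hn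
    exact middle_nonneg m hnk
  · induction n, hnk using Nat.le_induction with
    | base =>
      obtain ⟨m, rfl⟩ := Nat.exists_eq_add_of_le hjk
      exact middle_nonneg m le_rfl
    | succ n hkn ih =>
      rw [sum_range_succ]
      exact add_nonneg (ih (by omega))
        (mul_nonneg (iterEntry_nonneg h0 h1 (by omega)) (iterEntry_nonneg h0 h1 hkn))

/-- Closed form of the iteration matrix `I - Γ⁻¹A`. -/
lemma one_sub_tril_inv_mul (n : ℕ) (σ : ℝ) (A : Matrix (Fin n) (Fin n) ℝ)
    (hA : ∀ i j, A i j = if i = j then 1 else 1 - σ) :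
    1 - (tril n A)⁻¹ * A = Matrix.of fun i j : Fin n => iterEntry σ j i := by
  set P : Matrix (Fin n) (Fin n) ℝ := Matrix.of fun i j : Fin n => iterEntry σ j i with hP
  have hdet : (tril n A).det = 1 := by
    rw [Matrix.det_of_isLowerTriangular]
    · simp [tril, hA]
    · intro i j hij
      have : i < j := hij
      simp [tril, this.not_ge]
  have hmul : tril n A * P = tril n A - A := by
    ext i j
    have hsum : (tril n A * P) i j =
        iterEntry σ j i + (1 - σ) * (σ ^ (i : ℕ) - σ ^ ((i : ℕ) - j)) := by
      rw [← sum_range_iterEntry, ← sum_range_unit_lower_mul _ _ _ n i.2,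
        ← Fin.sum_univ_eq_sum_range (fun k =>
          (if k ≤ (i : ℕ) then (if (i : ℕ) = k then 1 else 1 - σ) else 0) * iterEntry σ j k),
        Matrix.mul_apply]
      simp [tril, hA, hP, Fin.ext_iff]
    rw [hsum, Matrix.sub_apply, tril, Matrix.of_apply, hA]
    rcases lt_or_ge i j with h | h
    · have h' : (i : ℕ) < j := h
      rw [if_neg h.not_ge, if_neg h.ne, iterEntry_of_lt h', Nat.sub_eq_zero_of_le h'.le]
      ring
    · obtain ⟨m, hm⟩ := Nat.exists_eq_add_of_le (show (j : ℕ) ≤ i from h)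
      rw [if_pos h, hm, iterEntry_add, Nat.add_sub_cancel_left]
      ring
  have hfac : A = tril n A * (1 - P) := by
    rw [mul_sub, hmul, mul_one, sub_sub_cancel]
  have hinv : (tril n A)⁻¹ * A = 1 - P := by
    calc (tril n A)⁻¹ * A = (tril n A)⁻¹ * (tril n A * (1 - P)) := by rw [← hfac]
      _ = 1 - P := Matrix.nonsing_inv_mul_cancel_left _ _ (by simp [hdet])
  rw [hinv, sub_sub_cancel]

lemma sum_sq_le_sq_sum_of_nonpos {ι : Type*} (s : Finset ι) (f : ι → ℝ) (hf : ∀ i ∈ s, f i ≤ 0) :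
    ∑ i ∈ s, f i ^ 2 ≤ (∑ i ∈ s, f i) ^ 2 := by
  have := Finset.sum_sq_le_sq_sum_of_nonneg (s := s) (f := fun i => -f i)
    fun i hi => neg_nonneg.2 (hf i hi)
  simpa using this

/-- Lemma B.3 (nonnegativity of the entries of the 2×2 iteration matrix `M_A`):
for `A = σI + (1-σ)𝟙𝟙ᵀ`, `Γ = tril A`, `C = I - Γ⁻¹A`, the quantities
`nβ - α`, `nδ - γ`, `α - β`, `γ - δ` are all nonnegative. -/
theorem tau_entries_nonneg (n : ℕ) (hn : 2 ≤ n) (σ : ℝ) (hσ0 : 0 < σ) (hσ1 : σ ≤ 1) :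
    let A : Matrix (Fin n) (Fin n) ℝ :=
      σ • (1 : Matrix (Fin n) (Fin n) ℝ) + (1 - σ) • Matrix.of (fun _ _ : Fin n => (1 : ℝ))
    let C : Matrix (Fin n) (Fin n) ℝ := 1 - (tril n A)⁻¹ * A
    let one : Fin n → ℝ := fun _ => 1
    let α : ℝ := C.mulVec one ⬝ᵥ C.mulVec one
    let β : ℝ := Matrix.trace (Cᵀ * C)
    let γ : ℝ := (one ⬝ᵥ C.mulVec one) ^ 2
    let δ : ℝ := Cᵀ.mulVec one ⬝ᵥ Cᵀ.mulVec one
    0 ≤ (n : ℝ) * β - α ∧ 0 ≤ (n : ℝ) * δ - γ ∧ 0 ≤ α - β ∧ 0 ≤ γ - δ := by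
  intro A C one α β γ δ
  have hC : C = Matrix.of fun i j : Fin n => iterEntry σ j i :=
    one_sub_tril_inv_mul n σ A fun i j => by
      by_cases h : i = j <;> simp [A, h]
  have hα : α = ∑ i, (∑ j, C i j) ^ 2 := by
    simp [α, one, dotProduct, Matrix.mulVec, sq]
  have hβ : β = ∑ i, ∑ j, C i j ^ 2 := by
    rw [Finset.sum_comm]
    simp [β, Matrix.trace, Matrix.mul_apply, sq]
  have hγ : γ = (∑ j, ∑ i, C i j) ^ 2 := by
    rw [Finset.sum_comm]
    simp [γ, one, dotProduct, Matrix.mulVec]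
  have hδ : δ = ∑ j, (∑ i, C i j) ^ 2 := by
    simp [δ, one, dotProduct, Matrix.mulVec, sq]
  have hgram : ∀ j k, 0 ≤ ∑ i, C i j * C i k := by
    intro j k
    simp only [hC, Matrix.of_apply]
    rw [Fin.sum_univ_eq_sum_range (fun i => iterEntry σ j i * iterEntry σ k i)]
    rcases le_total j k with h | h
    · exact sum_iterEntry_mul_nonneg hσ0.le hσ1 h n
    · simp only [mul_comm (iterEntry σ j _)]
      exact sum_iterEntry_mul_nonneg hσ0.le hσ1 h n
  have hcol : ∀ j, ∑ i, C i j ≤ 0 := by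
    intro j
    simp only [hC, Matrix.of_apply]
    rw [Fin.sum_univ_eq_sum_range (iterEntry σ j), sum_range_iterEntry, sub_nonpos]
    exact pow_le_pow_of_le_one hσ0.le hσ1 (Nat.sub_le _ _)
  refine ⟨?_, ?_, ?_, ?_⟩ <;> rw [sub_nonneg]
  · rw [hα, hβ, Finset.mul_sum]
    refine Finset.sum_le_sum fun i _ => ?_
    simpa using sq_sum_le_card_mul_sum_sq (s := Finset.univ) (f := fun j => C i j)
  · rw [hγ, hδ]
    simpa using sq_sum_le_card_mul_sum_sq (s := Finset.univ) (f := fun j => ∑ i, C i j)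
  · have hα' : α = ∑ j, ∑ k, ∑ i, C i j * C i k := by
      simp_rw [hα, sq, Finset.sum_mul_sum]
      rw [Finset.sum_comm]
      exact Finset.sum_congr rfl fun j _ => Finset.sum_comm
    rw [hα', hβ, Finset.sum_comm]
    refine Finset.sum_le_sum fun j _ => ?_
    simp_rw [sq]
    exact Finset.single_le_sum (f := fun k => ∑ i, C i j * C i k) (fun k _ => hgram j k)
      (Finset.mem_univ j)
  · rw [hγ, hδ]
    exact sum_sq_le_sq_sum_of_nonpos _ _ fun j _ => hcol j
end

section
/- For every integer n ≥ 2 and every real σ ∈ [0,1]: 0 ≤ (n − (n−1)σ) · (Σ_{i=0}^{n−1} σⁱ) − n ≤ n · (n/(n+1))^{n−1} − 1. -/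
theorem pow_mul_succ_sub_mul_le_one (n : ℕ) {s : ℝ} (hs : 0 ≤ s) :
    s ^ n * ((n : ℝ) + 1 - n * s) ≤ 1 := by
  induction n with
  | zero => simp
  | succ n ih =>
    have h : 0 ≤ s ^ n * (((n : ℝ) + 1) * (1 - s) ^ 2) := by positivity
    push_cast
    rw [pow_succ]
    linear_combination ih + h

/-- The maximum of `n σⁿ (1 - σ)` over `σ ≥ 0` is attained at `σ = n / (n + 1)`. -/
theorem mul_pow_mul_one_sub_le {n : ℕ} (hn : 1 ≤ n) {σ : ℝ} (hσ : 0 ≤ σ) :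
    (n : ℝ) * σ ^ n * (1 - σ) ≤ ((n : ℝ) / (n + 1)) ^ (n + 1) := by
  have hn0 : (0 : ℝ) < n := by exact_mod_cast hn
  set r : ℝ := (n : ℝ) / (n + 1) with hr
  have hr0 : 0 < r := by positivity
  have hrn : r * ((n : ℝ) + 1) = n := by rw [hr]; field_simp
  obtain ⟨s, hs, rfl⟩ : ∃ s : ℝ, 0 ≤ s ∧ σ = r * s :=
    ⟨σ / r, by positivity, by field_simp⟩
  have key := mul_le_mul_of_nonneg_left (pow_mul_succ_sub_mul_le_one n hs)
    (by positivity : 0 ≤ r ^ (n + 1))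
  calc (n : ℝ) * (r * s) ^ n * (1 - r * s)
      = r ^ (n + 1) * (s ^ n * ((n : ℝ) + 1 - n * s)) := by
        rw [mul_pow, pow_succ]
        linear_combination (-(r ^ n * s ^ n)) * hrn
    _ ≤ r ^ (n + 1) := by simpa using key

theorem mul_div_succ_pow_add_le {n : ℕ} (hn : 1 ≤ n) :
    (n : ℝ) * ((n : ℝ) / (n + 1)) ^ (n - 1) + ((n : ℝ) / (n + 1)) ^ (n + 1) ≤
      ((n : ℝ) + 1) * (((n : ℝ) + 1) / (n + 1 + 1)) ^ n := by
  have hn0 : (0 : ℝ) < n := by exact_mod_cast hn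
  set r : ℝ := (n : ℝ) / (n + 1) with hr
  have hr0 : 0 < r := by positivity
  have hrn : (n : ℝ) = ((n : ℝ) + 1) * r := by rw [hr]; field_simp
  have hq : ((n : ℝ) + 1) / (n + 1 + 1) = r * (1 + 1 / (n * (n + 2))) := by
    rw [hr]; field_simp; ring
  have hb : 1 + (n : ℝ) * (1 / (n * (n + 2))) ≤ (1 + 1 / ((n : ℝ) * (n + 2))) ^ n :=
    one_add_mul_le_pow (by linarith [show 0 ≤ 1 / ((n : ℝ) * (n + 2)) by positivity]) n
  have hc : (n : ℝ) + 1 + r ≤ (n + 1) * (1 + 1 / ((n : ℝ) * (n + 2))) ^ n := by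
    have h : (n : ℝ) + 1 + r ≤ (n + 1) * (1 + (n : ℝ) * (1 / (n * (n + 2)))) := by
      rw [hr, ← sub_nonneg]
      have : ((n : ℝ) + 1) * (1 + (n : ℝ) * (1 / (n * (n + 2)))) - (n + 1 + n / (n + 1)) =
          1 / ((n + 1) * (n + 2)) := by field_simp; ring
      rw [this]; positivity
    exact h.trans (by gcongr)
  have hl : (n : ℝ) * r ^ (n - 1) = (n + 1) * r ^ n := by
    conv_lhs => rw [hrn]
    rw [mul_assoc, mul_pow_sub_one (by omega)]
  rw [hl, hq, mul_pow, pow_succ]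
  linear_combination r ^ n * hc

theorem succ_mul_geom_sum_eq (n : ℕ) (σ : ℝ) :
    ((n : ℝ) + 1 - n * σ) * (∑ i ∈ Finset.range (n + 1), σ ^ i) - (n + 1) =
      ((n : ℝ) - ((n : ℝ) - 1) * σ) * (∑ i ∈ Finset.range n, σ ^ i) - n +
        n * σ ^ n * (1 - σ) := by
  rw [Finset.sum_range_succ]
  linear_combination mul_neg_geom_sum σ n

/-- Lemma B.9: for `n ≥ 2` and `σ ∈ [0,1]`,
`0 ≤ (n − (n−1)σ)·(1 + σ + ⋯ + σ^{n−1}) − n ≤ n·(n/(n+1))^{n−1} − 1`. -/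
theorem L_times_geom_bounds (n : ℕ) (hn : 2 ≤ n) (σ : ℝ) (h0 : 0 ≤ σ) (h1 : σ ≤ 1) :
    0 ≤ ((n : ℝ) - ((n : ℝ) - 1) * σ) * (∑ i ∈ Finset.range n, σ ^ i) - n ∧
    ((n : ℝ) - ((n : ℝ) - 1) * σ) * (∑ i ∈ Finset.range n, σ ^ i) - n ≤
      (n : ℝ) * ((n : ℝ) / ((n : ℝ) + 1)) ^ (n - 1) - 1 := by
  have hn1 : 1 ≤ n := by omega
  clear hn
  induction n, hn1 using Nat.le_induction with
  | base => simp
  | succ n hn ih =>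
    have h := succ_mul_geom_sum_eq n σ
    have hpos : 0 ≤ (n : ℝ) * σ ^ n * (1 - σ) :=
      mul_nonneg (by positivity) (sub_nonneg.mpr h1)
    have hmax := mul_pow_mul_one_sub_le hn h0
    have hstep := mul_div_succ_pow_add_le hn
    push_cast
    rw [add_sub_cancel_right, h]
    exact ⟨by linarith [ih.1], by linarith [ih.2]⟩
end

section
/- For every integer n ≥ 2, setting r_n = n · (n/(n+1))^{n−1} − 1, one has r_n² ≤ n(n−1)/e², where e is Euler's number. -/
/-- An upper bound for `(x/(x+1))^k` with `x = k + 1`, from `2t/(t+2) ≤ log (1+t)` and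
`exp y ≤ 1 + y + y²`. -/
theorem div_add_one_pow_mul_exp_one_le (k : ℕ) (x : ℝ) (hx : x = k + 1) (h2 : 2 ≤ x) :
    (x / (x + 1)) ^ k * Real.exp 1 ≤ 1 + 21 / 10 / x := by
  have hx0 : 0 < x := by linarith
  have hbase : x / (x + 1) ≤ Real.exp (-(2 / (2 * x + 1))) := by
    have hlog := Real.le_log_one_add_of_nonneg (x := 1 / x) (by positivity)
    have h1 : 2 * (1 / x) / (1 / x + 2) = 2 / (2 * x + 1) := by field_simp; ring
    have h3 : x / (x + 1) = (1 + 1 / x)⁻¹ := by field_simp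
    rw [h1] at hlog
    rw [Real.exp_neg, h3]
    gcongr
    exact (Real.le_log_iff_exp_le (by positivity)).1 hlog
  set y : ℝ := 3 / (2 * x + 1) with hy
  have hy0 : 0 ≤ y := by positivity
  have hy1 : y ≤ 1 := by
    rw [hy, div_le_one (by positivity)]; linarith
  have hexp : Real.exp y ≤ 1 + y + y ^ 2 := by
    have h := Real.abs_exp_sub_one_sub_id_le (x := y) (by rwa [abs_of_nonneg hy0])
    linarith [(abs_le.1 h).2]
  calc (x / (x + 1)) ^ k * Real.exp 1
      ≤ Real.exp (-(2 / (2 * x + 1))) ^ k * Real.exp 1 := by gcongr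
    _ = Real.exp y := by
      rw [← Real.exp_nat_mul, ← Real.exp_add, eq_sub_of_add_eq hx.symm, hy]
      congr 1
      field_simp
      ring
    _ ≤ 1 + y + y ^ 2 := hexp
    _ ≤ 1 + 21 / 10 / x := by
      have h : y + y ^ 2 = (6 * x + 12) / (2 * x + 1) ^ 2 := by rw [hy]; field_simp; ring
      have h' : (6 * x + 12) / (2 * x + 1) ^ 2 ≤ 21 / 10 / x := by
        rw [div_le_div_iff₀ (by positivity) hx0]
        nlinarith
      linarith

/-- Bernoulli's inequality gives `1 ≤ x (x/(x+1))^k` for `x = k + 1`. -/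
theorem one_le_mul_div_add_one_pow (k : ℕ) (x : ℝ) (hx : x = k + 1) (h1 : 1 ≤ x) :
    1 ≤ x * (x / (x + 1)) ^ k := by
  have hx0 : 0 < x := by linarith
  have hsmall : 1 / (x + 1) ≤ 1 := by rw [div_le_one (by positivity)]; linarith
  have hb := one_add_mul_le_pow (a := -(1 / (x + 1))) (by linarith) k
  have e1 : 1 + -(1 / (x + 1)) = x / (x + 1) := by field_simp; ring
  have e2 : 1 + (k : ℝ) * -(1 / (x + 1)) = 2 / (x + 1) := by
    rw [eq_sub_of_add_eq hx.symm]; field_simp; ring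
  rw [e1, e2] at hb
  calc (1 : ℝ) ≤ x * (2 / (x + 1)) := by
        rw [← mul_div_assoc, one_le_div (by positivity)]; linarith
    _ ≤ _ := by gcongr

/-- Lemma B.10: with `r_n = n·(n/(n+1))^{n−1} − 1`, one has `r_n² ≤ n(n−1)/e²`. -/
theorem rn_sq_le (n : ℕ) (hn : 2 ≤ n) :
    ((n : ℝ) * ((n : ℝ) / ((n : ℝ) + 1)) ^ (n - 1) - 1) ^ 2 ≤
      (n : ℝ) * ((n : ℝ) - 1) / (Real.exp 1) ^ 2 := by
  have h2 : (2 : ℝ) ≤ n := by exact_mod_cast hn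
  have hk : (n : ℝ) = (n - 1 : ℕ) + 1 := by
    rw [Nat.cast_sub (by lia)]; simp
  have hup := div_add_one_pow_mul_exp_one_le (n - 1) n hk h2
  have hlow := one_le_mul_div_add_one_pow (n - 1) n hk (by linarith)
  set x := (n : ℝ)
  set p := (x / (x + 1)) ^ (n - 1)
  have he := Real.exp_one_gt_d9
  rw [le_div_iff₀ (by positivity), ← mul_pow]
  have hnonneg : 0 ≤ (x * p - 1) * Real.exp 1 :=
    mul_nonneg (by linarith) (Real.exp_pos 1).le
  have hle : (x * p - 1) * Real.exp 1 ≤ x - 3 / 5 := by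
    have h := mul_le_mul_of_nonneg_left hup (by linarith : 0 ≤ x)
    have e : x * (1 + 21 / 10 / x) = x + 21 / 10 := by field_simp
    linarith
  calc ((x * p - 1) * Real.exp 1) ^ 2 ≤ (x - 3 / 5) ^ 2 := by gcongr
    _ ≤ x * (x - 1) := by linarith
end

section
/- For every real number x with 0 < x < 1, one has x^{x/(1−x)} − x^{1/(1−x)} ≤ exp(−(4 log 2) · x), where the powers are real powers and log denotes the natural logarithm. -/
theorem hasSum_pow_div_succ {x : ℝ} (h0 : 0 < x) (h1 : x < 1) :
    HasSum (fun n : ℕ => x ^ n / (n + 1)) (-Real.log (1 - x) / x) := by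
  have h := (Real.hasSum_pow_div_log_of_abs_lt_one (abs_lt.2 ⟨by linarith, h1⟩)).div_const x
  refine h.congr_fun fun n => ?_
  have : (n : ℝ) + 1 ≠ 0 := by positivity
  field_simp
  exact (pow_succ x n).symm

theorem two_mul_half_pow_le {x y : ℝ} (hx : 0 ≤ x) (hy : 0 ≤ y) (hxy : x + y = 1) (n : ℕ) :
    2 * (1 / 2 : ℝ) ^ n ≤ x ^ n + y ^ n := by
  have h := add_pow_le hx hy n
  rw [hxy, one_pow] at h
  rcases n with _ | n
  · norm_num
  · have h2 : (0 : ℝ) < 2 ^ n := by positivity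
    rw [Nat.add_sub_cancel] at h
    rw [pow_succ, one_div, inv_pow]
    field_simp
    linarith

/-- The binary entropy dominates the parabola with the same zeros and the same maximum. -/
theorem four_log_two_mul_le_binEntropy {x : ℝ} (h0 : 0 < x) (h1 : x < 1) :
    4 * Real.log 2 * (x * (1 - x)) ≤ -(x * Real.log x) - (1 - x) * Real.log (1 - x) := by
  have hy : 0 < 1 - x := by linarith
  have hsum := (hasSum_pow_div_succ h0 h1).add
    (hasSum_pow_div_succ hy (by linarith : 1 - x < 1))
  have hhalf := (hasSum_pow_div_succ (x := 1 / 2) (by norm_num) (by norm_num)).mul_left 2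
  have hle := hasSum_le (fun n => ?_) hhalf hsum
  · have hlog : Real.log (1 - 1 / 2) = -Real.log 2 := by
      rw [← Real.log_inv]; norm_num
    rw [hlog, sub_sub_cancel, div_add_div _ _ h0.ne' hy.ne', le_div_iff₀ (by positivity)] at hle
    linarith
  · rw [← add_div, ← mul_div_assoc]
    gcongr
    exact two_mul_half_pow_le h0.le hy.le (by ring) n

/-- Lemma B.11: for `0 < x < 1`,
`x^{x/(1−x)} − x^{1/(1−x)} ≤ exp(−(4 log 2)·x)` (real powers). -/
theorem rpow_diff_le_exp (x : ℝ) (h0 : 0 < x) (h1 : x < 1) :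
    x ^ (x / (1 - x)) - x ^ (1 / (1 - x)) ≤ Real.exp (-(4 * Real.log 2) * x) := by
  have hy : 0 < 1 - x := by linarith
  have hexp : 1 / (1 - x) = x / (1 - x) + 1 := by field_simp; ring
  have hfac : x ^ (x / (1 - x)) - x ^ (1 / (1 - x)) =
      Real.exp (Real.log x * (x / (1 - x)) + Real.log (1 - x)) := by
    rw [hexp, Real.rpow_add h0, Real.rpow_one, Real.exp_add, Real.exp_log hy,
      Real.rpow_def_of_pos h0]
    ring
  rw [hfac, Real.exp_le_exp]
  have key := four_log_two_mul_le_binEntropy h0 h1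
  refine le_of_mul_le_mul_right ?_ hy
  have hmul : (Real.log x * (x / (1 - x)) + Real.log (1 - x)) * (1 - x) =
      x * Real.log x + (1 - x) * Real.log (1 - x) := by field_simp
  rw [hmul]
  linarith
end

section
/- For every real number x > 1, one has (x/(x+1))^{x−1} − 1/x ≤ 1/e, where the power is a real power and e is Euler's number. -/
/-- Lemma B.12: for `x > 1`, `(x/(x+1))^{x−1} − 1/x ≤ 1/e` (real power). -/
theorem rpow_ratio_le_inv_e (x : ℝ) (hx : 1 < x) :
    (x / (x + 1)) ^ (x - 1) - 1 / x ≤ 1 / Real.exp 1 := by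
  have hx0 : 0 < x := by linarith
  have he : 2 ≤ Real.exp 1 := by linarith [Real.add_one_le_exp (1 : ℝ)]
  have hlog : Real.log (x / (x + 1)) ≤ -(2 / (2 * x + 1)) := by
    have h := Real.le_log_one_add_of_nonneg (x := 1 / x) (by positivity)
    have h₁ : 2 * (1 / x) / (1 / x + 2) = 2 / (2 * x + 1) := by
      field_simp
      ring
    have h₂ : x / (x + 1) = (1 + 1 / x)⁻¹ := by field_simp
    rw [h₂, Real.log_inv]
    linarith
  have hlog' : 3 / (2 * x + 1) ≤ Real.log (1 + Real.exp 1 / x) := by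
    refine le_trans ?_ (Real.le_log_one_add_of_nonneg (x := Real.exp 1 / x) (by positivity))
    have h : 2 * (Real.exp 1 / x) / (Real.exp 1 / x + 2) =
        2 * Real.exp 1 / (Real.exp 1 + 2 * x) := by field_simp
    rw [h, div_le_div_iff₀ (by positivity) (by positivity)]
    nlinarith
  have hexponent : Real.log (x / (x + 1)) * (x - 1) ≤ Real.log (1 + Real.exp 1 / x) - 1 := by
    have h₁ := mul_le_mul_of_nonneg_right hlog (sub_nonneg.2 hx.le)
    have h₂ : -(2 / (2 * x + 1)) * (x - 1) = 3 / (2 * x + 1) - 1 := by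
      field_simp
      ring
    linarith
  have hpow : (x / (x + 1)) ^ (x - 1) ≤ (1 + Real.exp 1 / x) / Real.exp 1 := by
    rw [Real.rpow_def_of_pos (by positivity)]
    refine (Real.exp_le_exp.2 hexponent).trans_eq ?_
    rw [Real.exp_sub, Real.exp_log (by positivity)]
  have hsplit : (1 + Real.exp 1 / x) / Real.exp 1 = 1 / Real.exp 1 + 1 / x := by
    field_simp
  linarith
end

section
/- Let n ≥ 3 and let a, b be real numbers. Let A be the n×n matrix with A_{ii} = 1 for all i, A_{1j} = A_{j1} = a for all j ≠ 1, and A_{ij} = b for all i ≠ j with i, j ≥ 2. Define the n×n matrices V₁ = e₁e₁ᵀ; V₂ with (V₂)_{1j} = (V₂)_{j1} = 1 for j ≠ 1 and all other entries 0; V₃ with (V₃)_{ii} = 1 for i ≥ 2 and all other entries 0; and V₄ with (V₄)_{ij} = 1 for all i, j ≥ 2 and all other entries 0. Then the linear span of {V₁, V₂, V₃, V₄} is invariant under the RPCD operator: for every matrix X in span{V₁, V₂, V₃, V₄}, M^RPCD_A(X) also belongs to span{V₁, V₂, V₃, V₄}. -/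
open Matrix

theorem mul_permMat (n : ℕ) (M : Matrix (Fin n) (Fin n) ℝ) (σ : Equiv.Perm (Fin n)) :
    M * permMat n σ = M.submatrix id σ := by
  ext i j
  simp [permMat, Matrix.mul_apply]

theorem permMat_transpose_mul (n : ℕ) (M : Matrix (Fin n) (Fin n) ℝ)
    (σ : Equiv.Perm (Fin n)) : (permMat n σ)ᵀ * M = M.submatrix σ id := by
  ext i j
  simp [permMat, Matrix.mul_apply]

theorem permMat_conj (n : ℕ) (M : Matrix (Fin n) (Fin n) ℝ) (σ : Equiv.Perm (Fin n)) :
    (permMat n σ)ᵀ * M * permMat n σ = M.submatrix σ σ := by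
  rw [permMat_transpose_mul, mul_permMat, Matrix.submatrix_submatrix]
  rfl

theorem permMat_transpose_mul_self (n : ℕ) (σ : Equiv.Perm (Fin n)) :
    (permMat n σ)ᵀ * permMat n σ = 1 := by
  ext i j
  rw [permMat_transpose_mul]
  simp [permMat, Matrix.one_apply]

theorem permMat_mul (n : ℕ) (σ p : Equiv.Perm (Fin n)) :
    permMat n (σ * p) = permMat n σ * permMat n p := by
  ext i j
  rw [mul_permMat]
  rfl

/-- The RPCD epoch matrices are equivariant under the permutations preserving `A`. -/
theorem rpcdMat_mul (n : ℕ) {A : Matrix (Fin n) (Fin n) ℝ} {σ : Equiv.Perm (Fin n)}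
    (hA : A.submatrix σ σ = A) (p : Equiv.Perm (Fin n)) :
    rpcdMat n A (σ * p) = permMat n σ * rpcdMat n A p * (permMat n σ)ᵀ := by
  rw [← permMat_conj] at hA
  have hQ := permMat_transpose_mul_self n σ
  have hQ' := mul_eq_one_comm.mp hQ
  have hconj : (permMat n (σ * p))ᵀ * A * permMat n (σ * p)
      = (permMat n p)ᵀ * A * permMat n p := by
    conv_rhs => rw [← hA]
    simp only [permMat_mul, Matrix.transpose_mul, Matrix.mul_assoc]
  have hcomm : (permMat n σ)ᵀ * A = A * (permMat n σ)ᵀ := by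
    conv_rhs => rw [← hA]
    rw [Matrix.mul_assoc _ (permMat n σ), hQ', Matrix.mul_one]
  rw [rpcdMat, rpcdMat, hconj, Matrix.mul_sub, Matrix.sub_mul, Matrix.mul_one, hQ']
  simp only [permMat_mul, Matrix.transpose_mul, Matrix.mul_assoc, hcomm]

theorem rpcdOp_submatrix (n : ℕ) {A X : Matrix (Fin n) (Fin n) ℝ} {σ : Equiv.Perm (Fin n)}
    (hA : A.submatrix σ σ = A) (hX : X.submatrix σ σ = X) :
    (rpcdOp n A X).submatrix σ σ = rpcdOp n A X := by
  have hQ := permMat_transpose_mul_self n σ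
  rw [← permMat_conj] at hX
  have hsum : ∑ p : Equiv.Perm (Fin n), (rpcdMat n A p)ᵀ * X * rpcdMat n A p
      = permMat n σ * (∑ p : Equiv.Perm (Fin n), (rpcdMat n A p)ᵀ * X * rpcdMat n A p)
        * (permMat n σ)ᵀ := by
    rw [Matrix.mul_sum, Matrix.sum_mul, ← Equiv.sum_comp (Equiv.mulLeft σ)]
    refine Finset.sum_congr rfl fun p _ => ?_
    rw [Equiv.coe_mulLeft, rpcdMat_mul n hA]
    conv_rhs => rw [← hX]
    simp only [Matrix.transpose_mul, Matrix.transpose_transpose, Matrix.mul_assoc]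
  rw [← permMat_conj, rpcdOp, Matrix.mul_smul, Matrix.smul_mul]
  conv_lhs => rw [hsum]
  simp only [Matrix.mul_assoc, hQ, Matrix.mul_one]
  rw [← Matrix.mul_assoc, hQ, Matrix.one_mul]

theorem rpcdOp_isSymm (n : ℕ) (A : Matrix (Fin n) (Fin n) ℝ) {X : Matrix (Fin n) (Fin n) ℝ}
    (hX : X.IsSymm) : (rpcdOp n A X).IsSymm := by
  rw [Matrix.IsSymm, rpcdOp, Matrix.transpose_smul, Matrix.transpose_sum]
  simp only [Matrix.transpose_mul, Matrix.transpose_transpose, hX.eq, Matrix.mul_assoc]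

/-- Entries of a matrix invariant under all permutations fixing the first index. -/
theorem apply_eq_of_forall_submatrix_eq {n : ℕ} (hn : 3 ≤ n) {Y : Matrix (Fin n) (Fin n) ℝ}
    (hY : ∀ σ : Equiv.Perm (Fin n), σ ⟨0, by omega⟩ = ⟨0, by omega⟩ → Y.submatrix σ σ = Y)
    (i j : Fin n) (hj : (j : ℕ) ≠ 0) :
    Y i j = if (i : ℕ) = 0 then Y ⟨0, by omega⟩ ⟨1, by omega⟩ else
      if i = j then Y ⟨1, by omega⟩ ⟨1, by omega⟩ else Y ⟨1, by omega⟩ ⟨2, by omega⟩ := by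
  have key : ∀ k l : Fin n, (k : ℕ) ≠ 0 → (l : ℕ) ≠ 0 → ∀ i j,
      Y i j = Y (Equiv.swap k l i) (Equiv.swap k l j) := by
    intro k l hk hl i j
    have h := hY (Equiv.swap k l)
      (Equiv.swap_apply_of_ne_of_ne (by grind) (by grind))
    exact (congrFun₂ h i j).symm
  split_ifs with h0 h1
  · rw [key j ⟨1, by omega⟩ hj one_ne_zero, Equiv.swap_apply_left,
      Equiv.swap_apply_of_ne_of_ne (by grind) (by grind)]
    congr 1
    exact Fin.ext h0
  · rw [h1, key j ⟨1, by omega⟩ hj one_ne_zero, Equiv.swap_apply_left]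
  · rw [key i ⟨1, by omega⟩ h0 one_ne_zero, Equiv.swap_apply_left]
    set k := Equiv.swap i ⟨1, by omega⟩ j with hk
    have hk0 : (k : ℕ) ≠ 0 := by grind
    have hk1 : k ≠ ⟨1, by omega⟩ := by grind
    rw [key k ⟨2, by omega⟩ hk0 two_ne_zero, Equiv.swap_apply_left,
      Equiv.swap_apply_of_ne_of_ne hk1.symm (by simp)]

/-- Lemma E.1 (partially invariant Hessians): for the `4`-basis block structure,
the span of `{V₁, V₂, V₃, V₄}` is invariant under the RPCD operator. -/
theorem rpcd_span_invariant (n : ℕ) (hn : 3 ≤ n) (a b : ℝ) :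
    let A : Matrix (Fin n) (Fin n) ℝ := Matrix.of fun i j =>
      if i = j then 1 else if (i : ℕ) = 0 ∨ (j : ℕ) = 0 then a else b
    let V₁ : Matrix (Fin n) (Fin n) ℝ := Matrix.of fun i j =>
      if (i : ℕ) = 0 ∧ (j : ℕ) = 0 then 1 else 0
    let V₂ : Matrix (Fin n) (Fin n) ℝ := Matrix.of fun i j =>
      if ((i : ℕ) = 0 ∧ (j : ℕ) ≠ 0) ∨ ((j : ℕ) = 0 ∧ (i : ℕ) ≠ 0) then 1 else 0
    let V₃ : Matrix (Fin n) (Fin n) ℝ := Matrix.of fun i j =>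
      if i = j ∧ (i : ℕ) ≠ 0 then 1 else 0
    let V₄ : Matrix (Fin n) (Fin n) ℝ := Matrix.of fun i j =>
      if (i : ℕ) ≠ 0 ∧ (j : ℕ) ≠ 0 then 1 else 0
    ∀ X ∈ Submodule.span ℝ ({V₁, V₂, V₃, V₄} : Set (Matrix (Fin n) (Fin n) ℝ)),
      rpcdOp n A X ∈ Submodule.span ℝ ({V₁, V₂, V₃, V₄} : Set (Matrix (Fin n) (Fin n) ℝ)) := by
  intro A V₁ V₂ V₃ V₄ X hX
  have hσ0 : ∀ σ : Equiv.Perm (Fin n), σ ⟨0, by omega⟩ = ⟨0, by omega⟩ →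
      ∀ i, (σ i : ℕ) = 0 ↔ (i : ℕ) = 0 := by
    intro σ hσ i
    have h := σ.injective.eq_iff (a := i) (b := ⟨0, by omega⟩)
    rwa [hσ, Fin.ext_iff, Fin.ext_iff] at h
  obtain ⟨x₁, x₂, x₃, x₄, rfl⟩ :
      ∃ x₁ x₂ x₃ x₄ : ℝ, x₁ • V₁ + x₂ • V₂ + x₃ • V₃ + x₄ • V₄ = X := by
    simp only [Submodule.mem_span_insert, Submodule.mem_span_singleton] at hX
    obtain ⟨x₁, _, ⟨x₂, _, ⟨x₃, _, ⟨x₄, rfl⟩, rfl⟩, rfl⟩, rfl⟩ := hX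
    exact ⟨x₁, x₂, x₃, x₄, by abel⟩
  have hsymm := rpcdOp_isSymm n A (X := x₁ • V₁ + x₂ • V₂ + x₃ • V₃ + x₄ • V₄) <| by
    ext i j
    simp only [V₁, V₂, V₃, V₄, Matrix.transpose_apply, Matrix.add_apply, Matrix.smul_apply,
      Matrix.of_apply]
    grind
  have hinv : ∀ σ : Equiv.Perm (Fin n), σ ⟨0, by omega⟩ = ⟨0, by omega⟩ →
      (rpcdOp n A (x₁ • V₁ + x₂ • V₂ + x₃ • V₃ + x₄ • V₄)).submatrix σ σ
        = rpcdOp n A (x₁ • V₁ + x₂ • V₂ + x₃ • V₃ + x₄ • V₄) := by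
    intro σ hσ
    apply rpcdOp_submatrix <;> ext i j <;>
      simp [A, V₁, V₂, V₃, V₄, hσ0 σ hσ]
  have happly := apply_eq_of_forall_submatrix_eq hn hinv
  generalize rpcdOp n A (x₁ • V₁ + x₂ • V₂ + x₃ • V₃ + x₄ • V₄) = Y at hsymm happly ⊢
  have hY : Y = Y ⟨0, by omega⟩ ⟨0, by omega⟩ • V₁ + Y ⟨0, by omega⟩ ⟨1, by omega⟩ • V₂
      + (Y ⟨1, by omega⟩ ⟨1, by omega⟩ - Y ⟨1, by omega⟩ ⟨2, by omega⟩) • V₃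
      + Y ⟨1, by omega⟩ ⟨2, by omega⟩ • V₄ := by
    ext i j
    simp only [V₁, V₂, V₃, V₄, Matrix.add_apply, Matrix.smul_apply, Matrix.of_apply,
      smul_eq_mul]
    by_cases hj : (j : ℕ) = 0
    · by_cases hi : (i : ℕ) = 0
      · have hi' : i = ⟨0, by omega⟩ := Fin.ext hi
        have hj' : j = ⟨0, by omega⟩ := Fin.ext hj
        simp [hi', hj']
      · have hij : i ≠ j := by grind
        rw [← hsymm.apply i j, happly j i hi]
        simp [hi, hj, hij]
    · rw [happly i j hj]
      by_cases hi : (i : ℕ) = 0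
      · simp [hi, hj]
      · by_cases hij : i = j <;> simp [hi, hj, hij]
  rw [hY]
  have hmem : ∀ V ∈ ({V₁, V₂, V₃, V₄} : Set (Matrix (Fin n) (Fin n) ℝ)), ∀ c : ℝ,
      c • V ∈ Submodule.span ℝ ({V₁, V₂, V₃, V₄} : Set (Matrix (Fin n) (Fin n) ℝ)) :=
    fun V hV c => Submodule.smul_mem _ c (Submodule.subset_span hV)
  exact add_mem (add_mem (add_mem (hmem V₁ (by simp) _) (hmem V₂ (by simp) _))
    (hmem V₃ (by simp) _)) (hmem V₄ (by simp) _)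
end

section
/- For every integer n ≥ 2 and every real σ with 0 < σ < 1: max{ (1 − 1/n)ⁿ, (1 − σ/n)^{2n} } < ( 1 − 1/n + (1−σ)²/n )ⁿ. In other words, the RPCD contraction-rate upper bound is strictly smaller than the RCD contraction-rate lower bound for every such n and σ. -/
/-- The RPCD contraction-rate upper bound is strictly smaller than the RCD
contraction-rate lower bound: for every `n ≥ 2` and `σ ∈ (0,1)`,
`max{(1 − 1/n)ⁿ, (1 − σ/n)^{2n}} < (1 − 1/n + (1−σ)²/n)ⁿ`. -/
theorem rpcd_bound_lt_rcd_bound (n : ℕ) (hn : 2 ≤ n)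
    (σ : ℝ) (h0 : 0 < σ) (h1 : σ < 1) :
    max ((1 - 1 / (n : ℝ)) ^ n) ((1 - σ / (n : ℝ)) ^ (2 * n)) <
      (1 - 1 / (n : ℝ) + (1 - σ) ^ 2 / (n : ℝ)) ^ n := by
  have hn_pos : (0 : ℝ) < n := by positivity
  have hn_one : 1 / (n : ℝ) < 1 := by
    rw [div_lt_one hn_pos]
    exact_mod_cast hn
  have hn_ne : n ≠ 0 := by lia
  refine max_lt ?_ ?_
  · refine pow_lt_pow_left₀ ?_ (by linarith) hn_ne
    have : 0 < (1 - σ) ^ 2 / (n : ℝ) := div_pos (pow_pos (sub_pos.2 h1) 2) hn_pos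
    linarith
  · rw [pow_mul]
    refine pow_lt_pow_left₀ ?_ (sq_nonneg _) hn_ne
    have hgap : 0 < σ ^ 2 / (n : ℝ) * (1 - 1 / (n : ℝ)) :=
      mul_pos (by positivity) (sub_pos.2 hn_one)
    have hdiff : 1 - 1 / (n : ℝ) + (1 - σ) ^ 2 / (n : ℝ) - (1 - σ / (n : ℝ)) ^ 2 =
        σ ^ 2 / (n : ℝ) * (1 - 1 / (n : ℝ)) := by
      ring
    linarith
end
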